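/- arXiv:math/0411438 — 3 statements merged into one kernel-verified Lean document; each statement's English description precedes it below -/
import Mathlib

section
/- Let σ > 0 and θ > 0. For Δ > 0 define p_Δ(x) = e^{−Δ} Σ_{k=0}^∞ (Δ^k/k!) · φ_{σ²Δ}(x − θk) and D_Δ(x) = e^{−Δ} Σ_{k=0}^∞ (Δ^k/k!) · φ_{σ²Δ}(x − θk) · k(x − θk)/(σ²Δ) (the θ-derivative of p_Δ). Then lim_{Δ→0} ∫ D_Δ(x)²/p_Δ(x) dx = 1/σ². -/
open MeasureTheory Filter Topology

/-- The centered Gaussian density with variance `v`. -/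
noncomputable def gauss (v x : ℝ) : ℝ :=
  (Real.sqrt (2 * Real.pi * v))⁻¹ * Real.exp (-(x ^ 2) / (2 * v))

/-- unit Gaussian density -/
noncomputable def g (u : ℝ) : ℝ := gauss 1 u

lemma g_eq (u : ℝ) : g u = (Real.sqrt (2 * Real.pi))⁻¹ * Real.exp (-(u ^ 2) / 2) := by
  simp [g, gauss]

lemma g_pos (u : ℝ) : 0 < g u := by
  rw [g_eq]; positivity

lemma g_cont : Continuous g := by
  have : g = fun u => (Real.sqrt (2 * Real.pi))⁻¹ * Real.exp (-(u ^ 2) / 2) := funext g_eq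
  rw [this]; fun_prop

lemma gauss_scale (s u : ℝ) (hs : 0 < s) : gauss (s ^ 2) (s * u) = s⁻¹ * g u := by
  rw [g_eq, gauss, Real.sqrt_mul (by positivity), Real.sqrt_sq hs.le]
  have : -(s * u) ^ 2 / (2 * s ^ 2) = -(u ^ 2) / 2 := by field_simp
  rw [this, mul_inv]; ring

lemma g_le_exp (u : ℝ) : g u ≤ (1 / 2) * Real.exp (-(u ^ 2) / 2) := by
  rw [g_eq]
  gcongr
  rw [one_div]
  apply inv_anti₀ (by norm_num)
  apply Real.le_sqrt_of_sq_le
  nlinarith [Real.pi_gt_three]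

lemma g_bound (u : ℝ) : g u * (1 + u ^ 2 / 2) ≤ 1 / 2 := by
  have h1 := g_le_exp u
  have h2 := Real.add_one_le_exp (u ^ 2 / 2)
  have h3 : Real.exp (-(u ^ 2) / 2) * Real.exp (u ^ 2 / 2) = 1 := by
    rw [← Real.exp_add]; ring_nf; simp
  have h4 := Real.exp_pos (-(u ^ 2) / 2)
  have h5 : 0 ≤ 1 + u ^ 2 / 2 := by positivity
  nlinarith [mul_le_mul_of_nonneg_right h1 h5]

lemma g_le_one (u : ℝ) : g u ≤ 1 := by
  nlinarith [g_bound u, g_pos u, mul_nonneg (g_pos u).le (sq_nonneg u)]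

lemma sq_g_le_one (u : ℝ) : u ^ 2 * g u ≤ 1 := by
  nlinarith [g_bound u, g_pos u, mul_nonneg (g_pos u).le (sq_nonneg u)]

lemma abs_g_le_one (u : ℝ) : |u * g u| ≤ 1 := by
  have := g_bound u
  have h := g_pos u
  rw [abs_le]
  constructor
  · nlinarith [mul_nonneg h.le (sq_nonneg (u + 1))]
  · nlinarith [mul_nonneg h.le (sq_nonneg (u - 1))]

lemma g_four (u : ℝ) : u ^ 4 * g u ≤ 4 := by
  have h1 := g_le_exp u
  have h2 := Real.quadratic_le_exp_of_nonneg (x := u ^ 2 / 2) (by positivity)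
  have h3 : Real.exp (-(u ^ 2) / 2) * Real.exp (u ^ 2 / 2) = 1 := by
    rw [← Real.exp_add]; ring_nf; simp
  have h4 := Real.exp_pos (-(u ^ 2) / 2)
  have h6 : u ^ 4 ≤ 8 * Real.exp (u ^ 2 / 2) := by nlinarith [sq_nonneg u]
  calc u ^ 4 * g u ≤ (8 * Real.exp (u ^ 2 / 2)) * ((1 / 2) * Real.exp (-(u ^ 2) / 2)) := by
        apply mul_le_mul h6 h1 (g_pos u).le (by positivity)
    _ = 4 := by linear_combination 4 * h3

lemma int_sq_g : ∫ u, u ^ 2 * g u = 1 := by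
  have h := ProbabilityTheory.variance_id_gaussianReal (μ := 0) (v := 1)
  rw [ProbabilityTheory.variance_of_integral_eq_zero aemeasurable_id
    (by simp [ProbabilityTheory.integral_id_gaussianReal]),
    ProbabilityTheory.integral_gaussianReal_eq_integral_smul (by norm_num)] at h
  simp only [NNReal.coe_one] at h
  rw [← h]
  congr 1
  ext u
  simp [ProbabilityTheory.gaussianPDFReal, g_eq, mul_comm]

lemma integrable_sq_g : Integrable (fun u => u ^ 2 * g u) := by
  by_contra hc
  have := int_sq_g
  rw [integral_undef hc] at this
  norm_num at this

lemma hs0 (Δ : ℝ) : HasSum (fun k : ℕ => Δ ^ k / (k.factorial : ℝ)) (Real.exp Δ) := by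
  rw [Real.exp_eq_exp_ℝ]; exact NormedSpace.expSeries_div_hasSum_exp Δ

lemma hs1 (Δ : ℝ) : HasSum (fun k : ℕ => Δ ^ k / (k.factorial : ℝ) * k) (Δ * Real.exp Δ) := by
  rw [← hasSum_nat_add_iff' 1]
  simp only [Finset.range_one, Finset.sum_singleton, Nat.cast_zero, mul_zero, sub_zero]
  convert! (hs0 Δ).mul_left Δ using 2 with k
  rw [Nat.factorial_succ]; push_cast
  field_simp; ring

lemma hs2 (Δ : ℝ) : HasSum (fun k : ℕ => Δ ^ k / (k.factorial : ℝ) * k ^ 2)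
    ((Δ + Δ ^ 2) * Real.exp Δ) := by
  rw [← hasSum_nat_add_iff' 1]
  simp only [Finset.range_one, Finset.sum_singleton, Nat.cast_zero, ne_eq, OfNat.ofNat_ne_zero,
    not_false_eq_true, zero_pow, mul_zero, sub_zero]
  have e : (Δ + Δ ^ 2) * Real.exp Δ = Δ * (Real.exp Δ + Δ * Real.exp Δ) := by ring
  rw [e]
  convert! ((hs0 Δ).add (hs1 Δ)).mul_left Δ using 2 with k
  rw [Nat.factorial_succ]; push_cast
  field_simp; ring

/-- shifted argument -/
noncomputable def U (τ z : ℝ) (k : ℕ) : ℝ := z - ((k : ℝ) - 1) * τ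

noncomputable def NN (Δ τ z : ℝ) : ℝ :=
  ∑' k : ℕ, Δ ^ k / (k.factorial : ℝ) * (k * (U τ z k * g (U τ z k)))
noncomputable def PP (Δ τ z : ℝ) : ℝ :=
  ∑' k : ℕ, Δ ^ k / (k.factorial : ℝ) * g (U τ z k)
noncomputable def QQ (Δ τ z : ℝ) : ℝ :=
  ∑' k : ℕ, Δ ^ k / (k.factorial : ℝ) * k ^ 2 * (U τ z k ^ 2 * g (U τ z k))

lemma bN {Δ : ℝ} (hΔ : 0 < Δ) (u : ℝ) (k : ℕ) :
    ‖Δ ^ k / (k.factorial : ℝ) * (k * (u * g u))‖ ≤ Δ ^ k / (k.factorial : ℝ) * k := by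
  have h := abs_g_le_one u
  have h' : 0 ≤ Δ ^ k / (k.factorial : ℝ) * k := by positivity
  rw [← mul_assoc, Real.norm_eq_abs, abs_mul, abs_of_nonneg h']
  exact mul_le_of_le_one_right h' h

lemma bP {Δ : ℝ} (hΔ : 0 < Δ) (u : ℝ) (k : ℕ) :
    ‖Δ ^ k / (k.factorial : ℝ) * g u‖ ≤ Δ ^ k / (k.factorial : ℝ) := by
  have h := g_le_one u
  have h' : 0 ≤ Δ ^ k / (k.factorial : ℝ) := by positivity
  rw [Real.norm_eq_abs, abs_of_nonneg (mul_nonneg h' (g_pos u).le)]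
  exact mul_le_of_le_one_right h' h

lemma bQ {Δ : ℝ} (hΔ : 0 < Δ) (u : ℝ) (k : ℕ) :
    ‖Δ ^ k / (k.factorial : ℝ) * k ^ 2 * (u ^ 2 * g u)‖ ≤ Δ ^ k / (k.factorial : ℝ) * k ^ 2 := by
  have h := sq_g_le_one u
  have h' : 0 ≤ Δ ^ k / (k.factorial : ℝ) * k ^ 2 := by positivity
  rw [Real.norm_eq_abs, abs_of_nonneg (mul_nonneg h' (mul_nonneg (sq_nonneg _) (g_pos u).le))]
  exact mul_le_of_le_one_right h' h

lemma sN {Δ : ℝ} (hΔ : 0 < Δ) (τ z : ℝ) :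
    Summable fun k : ℕ => Δ ^ k / (k.factorial : ℝ) * (k * (U τ z k * g (U τ z k))) :=
  Summable.of_norm_bounded (hs1 Δ).summable fun k => bN hΔ _ k
lemma sP {Δ : ℝ} (hΔ : 0 < Δ) (τ z : ℝ) :
    Summable fun k : ℕ => Δ ^ k / (k.factorial : ℝ) * g (U τ z k) :=
  Summable.of_norm_bounded (hs0 Δ).summable fun k => bP hΔ _ k
lemma sQ {Δ : ℝ} (hΔ : 0 < Δ) (τ z : ℝ) :
    Summable fun k : ℕ => Δ ^ k / (k.factorial : ℝ) * k ^ 2 * (U τ z k ^ 2 * g (U τ z k)) :=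
  Summable.of_norm_bounded (hs2 Δ).summable fun k => bQ hΔ _ k

lemma U_cont (τ : ℝ) (k : ℕ) : Continuous fun z => U τ z k := by
  unfold U; fun_prop

lemma N_cont {Δ : ℝ} (hΔ : 0 < Δ) (τ : ℝ) : Continuous (NN Δ τ) := by
  unfold NN
  refine continuous_tsum (fun k => ?_) (hs1 Δ).summable fun k z => bN hΔ _ k
  have h1 := U_cont τ k
  have h2 := g_cont.comp h1
  exact continuous_const.mul (continuous_const.mul (h1.mul h2))

lemma P_cont {Δ : ℝ} (hΔ : 0 < Δ) (τ : ℝ) : Continuous (PP Δ τ) := by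
  unfold PP
  refine continuous_tsum (fun k => ?_) (hs0 Δ).summable fun k z => bP hΔ _ k
  exact continuous_const.mul (g_cont.comp (U_cont τ k))

lemma P_pos {Δ : ℝ} (hΔ : 0 < Δ) (τ z : ℝ) : 0 < PP Δ τ z := by
  refine (sP hΔ τ z).tsum_pos (fun k => ?_) 0 ?_
  · have := g_pos (U τ z k); positivity
  · have := g_pos (U τ z 0); positivity

lemma jensen {Δ : ℝ} (hΔ : 0 < Δ) (τ z : ℝ) : NN Δ τ z ^ 2 / PP Δ τ z ≤ QQ Δ τ z := by
  have hP := P_pos hΔ τ z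
  set t := NN Δ τ z / PP Δ τ z with ht
  have h := (((sQ hΔ τ z).hasSum.sub ((sN hΔ τ z).hasSum.mul_left (2 * t))).add
    ((sP hΔ τ z).hasSum.mul_left (t ^ 2)))
  have h0 := h.nonneg (fun k => by
    have h1 : 0 ≤ Δ ^ k / (k.factorial : ℝ) * g (U τ z k) * (k * U τ z k - t) ^ 2 := by
      have := g_pos (U τ z k); positivity
    linarith)
  change 0 ≤ QQ Δ τ z - 2 * t * NN Δ τ z + t ^ 2 * PP Δ τ z at h0
  have e : QQ Δ τ z - 2 * t * NN Δ τ z + t ^ 2 * PP Δ τ z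
      = QQ Δ τ z - NN Δ τ z ^ 2 / PP Δ τ z := by
    rw [ht]; field_simp; ring
  linarith

lemma int_U (τ : ℝ) (k : ℕ) : ∫ z, (U τ z k ^ 2 * g (U τ z k)) = 1 := by
  unfold U
  rw [integral_sub_right_eq_self (fun u => u ^ 2 * g u), int_sq_g]

lemma integrable_U (τ : ℝ) (k : ℕ) : Integrable fun z => (U τ z k ^ 2 * g (U τ z k)) :=
  integrable_sq_g.comp_sub_right _

lemma int_Q {Δ : ℝ} (hΔ : 0 < Δ) (τ : ℝ) :
    ∫ z, QQ Δ τ z = (Δ + Δ ^ 2) * Real.exp Δ := by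
  have h := hasSum_integral_of_summable_integral_norm (μ := volume)
    (F := fun (k : ℕ) z => Δ ^ k / (k.factorial : ℝ) * k ^ 2 * (U τ z k ^ 2 * g (U τ z k)))
    (fun k => (integrable_U τ k).const_mul _) ?_
  · simp_rw [integral_const_mul, int_U, mul_one] at h
    exact h.unique (hs2 Δ)
  · refine (hs2 Δ).summable.congr fun k => ?_
    have : ∀ z, ‖Δ ^ k / (k.factorial : ℝ) * k ^ 2 * (U τ z k ^ 2 * g (U τ z k))‖ =
      Δ ^ k / (k.factorial : ℝ) * k ^ 2 * (U τ z k ^ 2 * g (U τ z k)) := fun z => by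
        apply Real.norm_of_nonneg
        have := g_pos (U τ z k); positivity
    simp_rw [this, integral_const_mul, int_U, mul_one]

lemma integrable_Q {Δ : ℝ} (hΔ : 0 < Δ) (τ : ℝ) : Integrable (QQ Δ τ) := by
  by_contra hc
  have := int_Q hΔ τ
  rw [integral_undef hc] at this
  have : 0 < (Δ + Δ ^ 2) * Real.exp Δ := by positivity
  linarith

noncomputable def FF (Δ τ z : ℝ) : ℝ := Real.exp (-Δ) * Δ⁻¹ * (NN Δ τ z ^ 2 / PP Δ τ z)

lemma F_nonneg {Δ : ℝ} (hΔ : 0 < Δ) (τ z : ℝ) : 0 ≤ FF Δ τ z := by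
  have := P_pos hΔ τ z
  unfold FF; positivity

lemma F_cont {Δ : ℝ} (hΔ : 0 < Δ) (τ : ℝ) : Continuous (FF Δ τ) :=
  continuous_const.mul (((N_cont hΔ τ).pow 2).div (P_cont hΔ τ) fun z => (P_pos hΔ τ z).ne')

lemma F_le {Δ : ℝ} (hΔ : 0 < Δ) (τ z : ℝ) : FF Δ τ z ≤ Real.exp (-Δ) * Δ⁻¹ * QQ Δ τ z := by
  unfold FF
  have := jensen hΔ τ z
  gcongr

lemma integrable_F {Δ : ℝ} (hΔ : 0 < Δ) (τ : ℝ) : Integrable (FF Δ τ) := by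
  refine ((integrable_Q hΔ τ).const_mul (Real.exp (-Δ) * Δ⁻¹)).mono'
    (F_cont hΔ τ).aestronglyMeasurable (Eventually.of_forall fun z => ?_)
  rw [Real.norm_of_nonneg (F_nonneg hΔ τ z)]
  exact F_le hΔ τ z

lemma int_F_le {Δ : ℝ} (hΔ : 0 < Δ) (τ : ℝ) : ∫ z, FF Δ τ z ≤ 1 + Δ := by
  have h := integral_mono (integrable_F hΔ τ)
    ((integrable_Q hΔ τ).const_mul (Real.exp (-Δ) * Δ⁻¹)) (F_le hΔ τ)
  rw [integral_const_mul, int_Q hΔ, Real.exp_neg] at h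
  have e : (Real.exp Δ)⁻¹ * Δ⁻¹ * ((Δ + Δ ^ 2) * Real.exp Δ) = 1 + Δ := by field_simp
  linarith

lemma tail {Δ : ℝ} (hΔ : 0 < Δ) (c : ℕ → ℝ) (hc : ∀ k : ℕ, 1 ≤ k → |c k| ≤ k)
    (hs : Summable fun k : ℕ => Δ ^ k / (k.factorial : ℝ) * c k) :
    |(∑' k : ℕ, Δ ^ k / (k.factorial : ℝ) * c k) - (c 0 + Δ * c 1)| ≤ Δ ^ 2 * Real.exp Δ := by
  rw [← hs.sum_add_tsum_nat_add 2]
  simp only [Finset.sum_range_succ, Finset.range_zero, Finset.sum_empty]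
  simp only [pow_zero, Nat.factorial, pow_one, Nat.cast_one, zero_add, mul_one, div_one, one_mul,
    add_sub_cancel_left]
  rw [← Real.norm_eq_abs]
  refine tsum_of_norm_bounded ((hs0 Δ).mul_left (Δ ^ 2)) fun k => ?_
  rw [Real.norm_eq_abs, abs_mul, abs_of_nonneg (by positivity)]
  have h1 : Δ ^ (k + 2) / ((k + 2) * ((k + 1) * (k.factorial : ℝ))) * |c (k + 2)|
     ≤ Δ ^ (k + 2) / ((k + 2) * ((k + 1) * (k.factorial : ℝ))) * (k + 2) := by
    have := hc (k + 2) (by omega)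
    push_cast at this
    gcongr
  have h2 : Δ ^ (k + 2) / ((k + 2) * ((k + 1) * (k.factorial : ℝ))) * (k + 2)
     = Δ ^ 2 * (Δ ^ k / (k.factorial : ℝ)) / (k + 1) := by
    rw [pow_add]; field_simp
  have h3 : Δ ^ 2 * (Δ ^ k / (k.factorial : ℝ)) / (k + 1) ≤ Δ ^ 2 * (Δ ^ k / (k.factorial : ℝ)) :=
    div_le_self (by positivity) (by linarith [(Nat.cast_nonneg k : (0 : ℝ) ≤ k)])
  push_cast
  have e : ((k : ℝ) + 1 + 1) = k + 2 := by ring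
  rw [e]
  linarith

lemma lim_N (τ : ℝ → ℝ) (z : ℝ) :
    Tendsto (fun Δ => NN Δ (τ Δ) z / Δ) (𝓝[>] 0) (𝓝 (z * g z)) := by
  rw [tendsto_iff_norm_sub_tendsto_zero]
  have hlim : Tendsto (fun Δ : ℝ => Δ * Real.exp Δ) (𝓝[>] 0) (𝓝 0) := by
    have : Continuous fun Δ : ℝ => Δ * Real.exp Δ := by fun_prop
    simpa using (this.tendsto 0).mono_left nhdsWithin_le_nhds
  refine squeeze_zero' (Eventually.of_forall fun _ => norm_nonneg _) ?_ hlim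
  filter_upwards [self_mem_nhdsWithin] with Δ hΔ
  have hΔ : 0 < Δ := hΔ
  have h := tail hΔ (fun k : ℕ => (k * (U (τ Δ) z k * g (U (τ Δ) z k)))) (fun k _ => by
    rw [abs_mul, Nat.abs_cast]
    exact mul_le_of_le_one_right (by positivity) (abs_g_le_one _)) (sN hΔ _ _)
  change |NN Δ (τ Δ) z - _| ≤ _ at h
  simp only [U, Nat.cast_zero, zero_mul, Nat.cast_one, sub_self, sub_zero, one_mul, zero_add] at h
  have e : NN Δ (τ Δ) z / Δ - z * g z = (NN Δ (τ Δ) z - Δ * (z * g z)) / Δ := by field_simp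
  rw [Real.norm_eq_abs, e, abs_div, abs_of_pos hΔ, div_le_iff₀ hΔ]
  linarith

lemma lim_P (τ : ℝ → ℝ) (C : ℝ) (hτ : Tendsto τ (𝓝[>] 0) atTop)
    (hC : ∀ Δ > 0, τ Δ ^ 4 * Δ ^ 2 = C) (hC0 : 0 < C) (z : ℝ) :
    Tendsto (fun Δ => PP Δ (τ Δ) z / Δ) (𝓝[>] 0) (𝓝 (g z)) := by
  rw [tendsto_iff_norm_sub_tendsto_zero]
  have hlim : Tendsto (fun Δ : ℝ => Δ * Real.exp Δ + 64 / C * Δ) (𝓝[>] 0) (𝓝 0) := by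
    have : Continuous fun Δ : ℝ => Δ * Real.exp Δ + 64 / C * Δ := by fun_prop
    simpa using (this.tendsto 0).mono_left nhdsWithin_le_nhds
  refine squeeze_zero' (Eventually.of_forall fun _ => norm_nonneg _) ?_ hlim
  filter_upwards [self_mem_nhdsWithin, hτ.eventually_ge_atTop (-2 * z),
    hτ.eventually_ge_atTop 0] with Δ hΔ hz h0
  have hΔ : 0 < Δ := hΔ
  have h := tail hΔ (fun k : ℕ => g (U (τ Δ) z k)) (fun k hk => by
    rw [abs_of_pos (g_pos _)]
    exact (g_le_one _).trans (by exact_mod_cast hk)) (sP hΔ _ _)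
  change |PP Δ (τ Δ) z - _| ≤ _ at h
  simp only [U, Nat.cast_zero, zero_sub, Nat.cast_one, sub_self, sub_zero, neg_mul, one_mul,
    sub_neg_eq_add, zero_mul] at h
  have hg := g_pos (z + τ Δ)
  have hb : g (z + τ Δ) ≤ 64 / C * Δ ^ 2 := by
    have h4 := g_four (z + τ Δ)
    have h5 : (τ Δ / 2) ^ 4 ≤ (z + τ Δ) ^ 4 := by
      apply pow_le_pow_left₀ <;> linarith
    have h6 : τ Δ ^ 4 * g (z + τ Δ) ≤ 64 := by
      have := mul_le_mul_of_nonneg_right h5 hg.le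
      nlinarith
    have h7 := mul_le_mul_of_nonneg_right h6 (sq_nonneg Δ)
    rw [div_mul_eq_mul_div, le_div_iff₀ hC0, ← hC Δ hΔ]
    linarith
  have e : PP Δ (τ Δ) z / Δ - g z = (PP Δ (τ Δ) z - Δ * g z) / Δ := by field_simp
  rw [Real.norm_eq_abs, e, abs_div, abs_of_pos hΔ, div_le_iff₀ hΔ]
  rw [abs_le] at h ⊢
  constructor <;> nlinarith [h.1, h.2]

lemma lim_F (τ : ℝ → ℝ) (C : ℝ) (hτ : Tendsto τ (𝓝[>] 0) atTop)
    (hC : ∀ Δ > 0, τ Δ ^ 4 * Δ ^ 2 = C) (hC0 : 0 < C) (z : ℝ) :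
    Tendsto (fun Δ => FF Δ (τ Δ) z) (𝓝[>] 0) (𝓝 (z ^ 2 * g z)) := by
  have h1 : Tendsto (fun Δ : ℝ => Real.exp (-Δ)) (𝓝[>] 0) (𝓝 1) := by
    have : Continuous fun Δ : ℝ => Real.exp (-Δ) := by fun_prop
    simpa using (this.tendsto 0).mono_left nhdsWithin_le_nhds
  have h := h1.mul (((lim_N τ z).pow 2).div (lim_P τ C hτ hC hC0 z) (g_pos z).ne')
  have e : 1 * ((z * g z) ^ 2 / g z) = z ^ 2 * g z := by
    have := (g_pos z).ne'
    field_simp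
  rw [e] at h
  refine h.congr' ?_
  filter_upwards [self_mem_nhdsWithin] with Δ hΔ
  have hΔ : 0 < Δ := hΔ
  have := (P_pos hΔ (τ Δ) z).ne'
  simp only [FF, Pi.div_apply]
  field_simp

lemma lim_int_F (τ : ℝ → ℝ) (C : ℝ) (hτ : Tendsto τ (𝓝[>] 0) atTop)
    (hC : ∀ Δ > 0, τ Δ ^ 4 * Δ ^ 2 = C) (hC0 : 0 < C) :
    Tendsto (fun Δ => ∫ z, FF Δ (τ Δ) z) (𝓝[>] 0) (𝓝 1) := by
  have hM : Continuous fun z : ℝ => z ^ 2 * g z := (continuous_pow 2).mul g_cont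
  have hM0 : ∀ z : ℝ, 0 ≤ z ^ 2 * g z := fun z => mul_nonneg (sq_nonneg _) (g_pos z).le
  have hlow : Tendsto (fun Δ => ∫ z, min (FF Δ (τ Δ) z) (z ^ 2 * g z)) (𝓝[>] 0) (𝓝 1) := by
    rw [← int_sq_g]
    refine tendsto_integral_filter_of_dominated_convergence (fun z => z ^ 2 * g z) ?_ ?_
      integrable_sq_g ?_
    · filter_upwards [self_mem_nhdsWithin] with Δ hΔ
      exact ((F_cont hΔ (τ Δ)).min hM).aestronglyMeasurable
    · filter_upwards [self_mem_nhdsWithin] with Δ hΔ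
      refine Eventually.of_forall fun z => ?_
      rw [Real.norm_of_nonneg (le_min (F_nonneg hΔ _ _) (hM0 z))]
      exact min_le_right _ _
    · refine Eventually.of_forall fun z => ?_
      have := (lim_F τ C hτ hC hC0 z).min (tendsto_const_nhds (x := z ^ 2 * g z))
      rwa [min_self] at this
  have hup : Tendsto (fun Δ : ℝ => 1 + Δ) (𝓝[>] 0) (𝓝 1) := by
    have : Continuous fun Δ : ℝ => 1 + Δ := by fun_prop
    simpa using (this.tendsto 0).mono_left nhdsWithin_le_nhds
  refine tendsto_of_tendsto_of_tendsto_of_le_of_le' hlow hup ?_ ?_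
  · filter_upwards [self_mem_nhdsWithin] with Δ hΔ
    refine integral_mono ?_ (integrable_F hΔ _) fun z => min_le_left _ _
    exact (integrable_F hΔ _).inf integrable_sq_g
  · filter_upwards [self_mem_nhdsWithin] with Δ hΔ
    exact int_F_le hΔ _

lemma change_var (σ θ Δ : ℝ) (hσ : 0 < σ) (hΔ : 0 < Δ) :
    ∫ x : ℝ, (Real.exp (-Δ) * ∑' k : ℕ, (Δ ^ k / (k.factorial : ℝ)) *
              (gauss (σ ^ 2 * Δ) (x - θ * k) * ((k : ℝ) * (x - θ * k) / (σ ^ 2 * Δ)))) ^ 2 /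
          (Real.exp (-Δ) * ∑' k : ℕ, (Δ ^ k / (k.factorial : ℝ)) *
              gauss (σ ^ 2 * Δ) (x - θ * k))
      = 1 / σ ^ 2 * ∫ z, FF Δ (θ / (σ * Real.sqrt Δ)) z := by
  set s := σ * Real.sqrt Δ with hs
  have hspos : 0 < s := by have := Real.sqrt_pos.2 hΔ; positivity
  have hs2 : σ ^ 2 * Δ = s ^ 2 := by rw [hs, mul_pow, Real.sq_sqrt hΔ.le]
  rw [hs2]
  set f : ℝ → ℝ := fun x => (Real.exp (-Δ) * ∑' k : ℕ, (Δ ^ k / (k.factorial : ℝ)) *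
              (gauss (s ^ 2) (x - θ * k) * ((k : ℝ) * (x - θ * k) / (s ^ 2)))) ^ 2 /
          (Real.exp (-Δ) * ∑' k : ℕ, (Δ ^ k / (k.factorial : ℝ)) *
              gauss (s ^ 2) (x - θ * k)) with hf
  have h1 : ∫ x, f x = s * ∫ z, f (s * z + θ) := by
    rw [Measure.integral_comp_mul_left (fun y => f (y + θ)), integral_add_right_eq_self f,
      abs_of_pos (by positivity), smul_eq_mul]
    field_simp
  rw [h1, ← integral_const_mul, ← integral_const_mul]
  congr 1
  ext z
  have hx : ∀ k : ℕ, s * z + θ - θ * k = s * U (θ / s) z k := fun k => by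
    unfold U; field_simp; ring
  have hP : ∑' k : ℕ, (Δ ^ k / (k.factorial : ℝ)) * gauss (s ^ 2) (s * z + θ - θ * k)
      = s⁻¹ * PP Δ (θ / s) z := by
    rw [PP, ← tsum_mul_left]
    congr 1; ext k
    rw [hx, gauss_scale _ _ hspos]; ring
  have hN : ∑' k : ℕ, (Δ ^ k / (k.factorial : ℝ)) * (gauss (s ^ 2) (s * z + θ - θ * k) *
      ((k : ℝ) * (s * z + θ - θ * k) / (s ^ 2))) = (s ^ 2)⁻¹ * NN Δ (θ / s) z := by
    rw [NN, ← tsum_mul_left]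
    congr 1; ext k
    rw [hx, gauss_scale _ _ hspos]; field_simp
  have hp := (P_pos hΔ (θ / s) z).ne'
  simp only [hf]
  rw [hP, hN, FF]
  have hσ2 : 1 / σ ^ 2 = Δ / s ^ 2 := by rw [← hs2]; field_simp
  rw [hσ2]
  have he := (Real.exp_pos (-Δ)).ne'
  field_simp

/-- Theorem 5.2, eq. Iaa_Y=Poisson with β = 2: the (θ,θ) Fisher information of a Brownian
motion plus Poisson process model converges to 1/σ² as Δ → 0. -/
theorem stmt_10 (σ θ : ℝ) (hσ : 0 < σ) (hθ : 0 < θ) :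
    Tendsto (fun Δ : ℝ =>
        ∫ x : ℝ,
          (Real.exp (-Δ) * ∑' k : ℕ, (Δ ^ k / (k.factorial : ℝ)) *
              (gauss (σ ^ 2 * Δ) (x - θ * k) * ((k : ℝ) * (x - θ * k) / (σ ^ 2 * Δ)))) ^ 2 /
          (Real.exp (-Δ) * ∑' k : ℕ, (Δ ^ k / (k.factorial : ℝ)) *
              gauss (σ ^ 2 * Δ) (x - θ * k)))
      (𝓝[>] 0) (𝓝 (1 / σ ^ 2)) := by
  have hτ : Tendsto (fun Δ : ℝ => θ / (σ * Real.sqrt Δ)) (𝓝[>] 0) atTop := by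
    have h1 : Tendsto (fun Δ : ℝ => σ * Real.sqrt Δ) (𝓝[>] 0) (𝓝[>] 0) := by
      refine tendsto_nhdsWithin_iff.2 ⟨?_, ?_⟩
      · have : Continuous fun Δ : ℝ => σ * Real.sqrt Δ := by fun_prop
        simpa using (this.tendsto 0).mono_left nhdsWithin_le_nhds
      · filter_upwards [self_mem_nhdsWithin] with Δ hΔ
        exact mul_pos hσ (Real.sqrt_pos.2 hΔ)
    simp_rw [div_eq_mul_inv]
    exact (tendsto_inv_nhdsGT_zero.comp h1).const_mul_atTop hθ
  have h := (lim_int_F (fun Δ => θ / (σ * Real.sqrt Δ)) (θ ^ 4 / σ ^ 4) hτ (fun Δ hΔ => by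
    have h4 : Real.sqrt Δ ^ 4 = Δ ^ 2 := by
      rw [show 4 = 2 * 2 from rfl, pow_mul, Real.sq_sqrt hΔ.le]
    have hΔ' : Δ ≠ 0 := ne_of_gt hΔ
    simp only [div_pow, mul_pow, h4]
    field_simp) (by positivity)).const_mul (1 / σ ^ 2)
  rw [mul_one] at h
  refine h.congr' ?_
  filter_upwards [self_mem_nhdsWithin] with Δ hΔ
  exact (change_var σ θ Δ hσ hΔ).symm
end

section
/- Let σ > 0 and θ > 0. For Δ > 0 define p_Δ(x) = e^{−Δ} Σ_{k=0}^∞ (Δ^k/k!) · φ_{σ²Δ}(x − θk), S_Δ(x) = e^{−Δ} Σ_{k=0}^∞ (Δ^k/k!) · φ_{σ²Δ}(x − θk) · ( (x − θk)²/(σ³Δ) − 1/σ ) (the σ-derivative of p_Δ), and D_Δ(x) = e^{−Δ} Σ_{k=0}^∞ (Δ^k/k!) · φ_{σ²Δ}(x − θk) · k(x − θk)/(σ²Δ) (the θ-derivative of p_Δ). Then lim_{Δ→0} ∫ S_Δ(x)·D_Δ(x)/p_Δ(x) dx = 0. -/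
open MeasureTheory Filter Topology

lemma core (u s d A B K : ℕ → ℝ) (hu : ∀ k, 0 ≤ u k) (hA : ∀ k, 0 ≤ A k) (hB : ∀ k, 0 ≤ B k)
    (hsu : Summable u) (hK : Summable K) (hle : ∀ k, u k * (A k + B k) ≤ K k)
    (hsd : ∀ j k, |s k| * |d j| ≤ A j + B k) :
    |(∑' k, u k * s k) * (∑' k, u k * d k) / ∑' k, u k| ≤ ∑' k, K k := by
  have hP : 0 ≤ ∑' k, u k := tsum_nonneg hu
  have hK0 : ∀ k, 0 ≤ K k := fun k =>
    (mul_nonneg (hu k) (add_nonneg (hA k) (hB k))).trans (hle k)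
  have hKs : 0 ≤ ∑' k, K k := tsum_nonneg hK0
  by_cases h1 : Summable fun k => u k * s k
  swap
  · rw [tsum_eq_zero_of_not_summable h1]; simpa using hKs
  by_cases h2 : Summable fun k => u k * d k
  swap
  · rw [tsum_eq_zero_of_not_summable h2]; simpa using hKs
  have hsA : Summable fun k => u k * A k := by
    refine Summable.of_nonneg_of_le (fun k => mul_nonneg (hu k) (hA k)) (fun k => ?_) hK
    nlinarith [hle k, mul_nonneg (hu k) (hB k)]
  have hsB : Summable fun k => u k * B k := by
    refine Summable.of_nonneg_of_le (fun k => mul_nonneg (hu k) (hB k)) (fun k => ?_) hK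
    nlinarith [hle k, mul_nonneg (hu k) (hA k)]
  have hAB : (∑' k, u k * A k) + ∑' k, u k * B k ≤ ∑' k, K k := by
    rw [← hsA.tsum_add hsB]
    refine (hsA.add hsB).tsum_le_tsum (fun k => ?_) hK
    have := hle k
    linarith
  have e1 : |∑' k, u k * s k| ≤ ∑' k, u k * |s k| := by
    have := norm_tsum_le_tsum_norm (f := fun k => u k * s k) h1.norm
    simpa [abs_mul, abs_of_nonneg (hu _)] using this
  have e2 : |∑' k, u k * d k| ≤ ∑' k, u k * |d k| := by
    have := norm_tsum_le_tsum_norm (f := fun k => u k * d k) h2.norm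
    simpa [abs_mul, abs_of_nonneg (hu _)] using this
  have h1' : Summable fun k => u k * |s k| := by
    simpa [abs_mul, abs_of_nonneg (hu _)] using h1.abs
  have h2' : Summable fun k => u k * |d k| := by
    simpa [abs_mul, abs_of_nonneg (hu _)] using h2.abs
  have i1 : ∀ k, |s k| * (∑' j, u j * |d j|) ≤ (∑' j, u j * A j) + B k * ∑' j, u j := by
    intro k
    rw [← tsum_mul_left, ← tsum_mul_left, ← hsA.tsum_add (hsu.mul_left _)]
    refine (h2'.mul_left _).tsum_le_tsum (fun j => ?_) (hsA.add (hsu.mul_left _))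
    have := mul_le_mul_of_nonneg_left (hsd j k) (hu j)
    linarith
  have i2 : (∑' k, u k * |s k|) * (∑' j, u j * |d j|)
      ≤ (∑' k, u k) * ((∑' k, u k * A k) + ∑' k, u k * B k) := by
    have : (∑' k, u k) * ((∑' k, u k * A k) + ∑' k, u k * B k)
        = ∑' k, (u k * (∑' j, u j * A j) + (u k * B k) * ∑' j, u j) := by
      rw [(hsu.mul_right _).tsum_add (hsB.mul_right _), tsum_mul_right, tsum_mul_right]; ring
    rw [this, ← tsum_mul_right]
    refine (h1'.mul_right _).tsum_le_tsum (fun k => ?_)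
      ((hsu.mul_right _).add (hsB.mul_right _))
    have := mul_le_mul_of_nonneg_left (i1 k) (hu k)
    linarith
  rw [abs_div, abs_mul, abs_of_nonneg hP]
  refine div_le_of_le_mul₀ hP hKs ?_
  calc _ ≤ (∑' k, u k * |s k|) * (∑' j, u j * |d j|) :=
        mul_le_mul e1 e2 (abs_nonneg _) ((abs_nonneg _).trans e1)
    _ ≤ _ := i2
    _ ≤ _ := by rw [mul_comm]; exact mul_le_mul_of_nonneg_right hAB hP

noncomputable def JJ (σ z : ℝ) : ℝ := gauss 1 z * (z ^ 2 / σ ^ 2 + 1 + ((z ^ 2 - 1) / σ) ^ 4)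

lemma gauss_nonneg (v x : ℝ) : 0 ≤ gauss v x := by unfold gauss; positivity

lemma JJ_nonneg (σ z : ℝ) : 0 ≤ JJ σ z := by
  unfold JJ
  have := gauss_nonneg 1 z
  positivity

lemma int_pow (n : ℕ) : Integrable (fun z : ℝ => z ^ n * Real.exp (-(1/2) * z ^ 2)) := by
  have := integrable_rpow_mul_exp_neg_mul_sq (b := 1/2) (by norm_num) (s := n)
    (by have : (0:ℝ) ≤ n := n.cast_nonneg
        linarith)
  simpa only [Real.rpow_natCast] using this

lemma JJ_int (σ : ℝ) : Integrable (JJ σ) := by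
  have h := ((((((int_pow 2).const_mul (1/σ^2)).add (int_pow 0)).add
    ((int_pow 8).const_mul (1/σ^4))).add ((int_pow 6).const_mul (-4/σ^4))).add
    (((int_pow 4).const_mul (6/σ^4)).add (((int_pow 2).const_mul (-4/σ^4)).add
      ((int_pow 0).const_mul (1/σ^4))))).const_mul ((Real.sqrt (2 * Real.pi * 1))⁻¹)
  refine h.congr (Eventually.of_forall fun z => ?_)
  simp only [Pi.add_apply, JJ, gauss]
  rw [show -z ^ 2 / (2 * 1) = -(1/2) * z ^ 2 by ring]
  ring

lemma gauss_scale_s11 (c y : ℝ) (hc : 0 < c) : gauss (c ^ 2) y = c⁻¹ * gauss 1 (y / c) := by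
  unfold gauss
  rw [Real.sqrt_mul (by positivity) (c ^ 2), Real.sqrt_sq hc.le, mul_one, mul_inv,
    show -y ^ 2 / (2 * c ^ 2) = -(y / c) ^ 2 / (2 * 1) by field_simp]
  ring

lemma coef (k : ℕ) (h a b : ℝ) (h0 : 0 < h) (h1 : h ≤ 1) (ha : 0 ≤ a) (hb : 0 ≤ b) :
    (h ^ 4) ^ k * ((k:ℝ) ^ 2 * a / h ^ 3 + (if k = 0 then 0 else 1 / h ^ 3) + h * b)
      ≤ 4 ^ k * (h * (a + 1 + b)) := by
  rcases Nat.eq_zero_or_pos k with rfl | hk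
  · simp; nlinarith [mul_nonneg h0.le ha]
  · have e1 : (h ^ 4) ^ k ≤ h ^ 4 := by
      have : h ^ 4 ≤ 1 := pow_le_one₀ h0.le h1
      simpa using pow_le_pow_of_le_one (by positivity) this hk
    have e2 : (k:ℝ) ^ 2 ≤ 4 ^ k := by
      have : (k:ℝ) ≤ 2 ^ k := by exact_mod_cast (Nat.lt_two_pow_self (n := k)).le
      calc (k:ℝ) ^ 2 ≤ (2 ^ k) ^ 2 := by gcongr
        _ = 4 ^ k := by rw [← pow_mul, mul_comm, pow_mul]; norm_num
    have e3 : (1:ℝ) ≤ 4 ^ k := one_le_pow₀ (by norm_num)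
    have e4 : h ^ 4 ≤ 1 := pow_le_one₀ h0.le h1
    rw [if_neg hk.ne']
    calc _ ≤ h ^ 4 * ((k:ℝ) ^ 2 * a / h ^ 3 + 1 / h ^ 3 + h * b) := by gcongr
      _ = h * ((k:ℝ) ^ 2 * a + 1 + h ^ 4 * b) := by field_simp
      _ ≤ h * (4 ^ k * a + 4 ^ k * 1 + 4 ^ k * b) := by
        gcongr
        · linarith
        · linarith
      _ = _ := by ring

lemma young (s d h : ℝ) (h0 : 0 < h) (t : ℝ) (ht : d = 0 ∧ t = 0 ∨ t = 1 / h ^ 3) :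
    |s| * |d| ≤ (h * d ^ 2 + t) + h * s ^ 4 := by
  rcases ht with ⟨rfl, rfl⟩ | rfl
  · simp; positivity
  · have e1 : |s| * |d| ≤ h * d ^ 2 + s ^ 2 / h := by
      rw [← sq_abs d, ← sq_abs s]
      have : h * |d| ^ 2 + |s| ^ 2 / h - |s| * |d|
        = ((h * |d| - |s|/2) ^ 2 + 3/4 * |s| ^ 2) / h := by field_simp; ring
      have h2 : 0 ≤ ((h * |d| - |s|/2) ^ 2 + 3/4 * |s| ^ 2) / h := by positivity
      linarith
    have e2 : s ^ 2 / h ≤ 1 / h ^ 3 + h * s ^ 4 := by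
      have : 1 / h ^ 3 + h * s ^ 4 - s ^ 2 / h
        = ((h ^ 2 * s ^ 2 - 1/2) ^ 2 + 3/4) / h ^ 3 := by field_simp; ring
      have h2 : 0 ≤ ((h ^ 2 * s ^ 2 - 1/2) ^ 2 + 3/4) / h ^ 3 := by positivity
      linarith
    linarith

noncomputable def KK (σ θ h : ℝ) (k : ℕ) (x : ℝ) : ℝ :=
  4 ^ k / (k.factorial : ℝ) * h * ((σ * h ^ 2)⁻¹ * JJ σ ((x - θ * k) / (σ * h ^ 2)))

lemma ptwise (σ θ h x : ℝ) (hσ : 0 < σ) (h0 : 0 < h) (h1 : h ≤ 1)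
    (hK : Summable fun k => KK σ θ h k x) :
    |(∑' k : ℕ, ((h ^ 4) ^ k / (k.factorial : ℝ)) *
              (gauss (σ ^ 2 * h ^ 4) (x - θ * k) * ((x - θ * k) ^ 2 / (σ ^ 3 * h ^ 4) - 1 / σ))) *
          (∑' k : ℕ, ((h ^ 4) ^ k / (k.factorial : ℝ)) *
              (gauss (σ ^ 2 * h ^ 4) (x - θ * k) * ((k : ℝ) * (x - θ * k) / (σ ^ 2 * h ^ 4)))) /
          (∑' k : ℕ, ((h ^ 4) ^ k / (k.factorial : ℝ)) *
              gauss (σ ^ 2 * h ^ 4) (x - θ * k))| ≤ ∑' k, KK σ θ h k x := by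
  simp only [← mul_assoc]
  have hu : ∀ k : ℕ, 0 ≤ (h ^ 4) ^ k / (k.factorial : ℝ) * gauss (σ ^ 2 * h ^ 4) (x - θ * k) :=
    fun k => mul_nonneg (by positivity) (gauss_nonneg _ _)
  refine core (fun k : ℕ => (h ^ 4) ^ k / (k.factorial : ℝ) * gauss (σ ^ 2 * h ^ 4) (x - θ * k))
    (fun k : ℕ => (x - θ * k) ^ 2 / (σ ^ 3 * h ^ 4) - 1 / σ)
    (fun k : ℕ => (k : ℝ) * (x - θ * k) / (σ ^ 2 * h ^ 4))
    (fun k : ℕ => h * ((k : ℝ) * (x - θ * k) / (σ ^ 2 * h ^ 4)) ^ 2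
      + if k = 0 then 0 else 1 / h ^ 3)
    (fun k : ℕ => h * ((x - θ * k) ^ 2 / (σ ^ 3 * h ^ 4) - 1 / σ) ^ 4)
    (fun k => KK σ θ h k x) hu ?_ ?_ ?_ hK ?_ ?_
  · intro k; split_ifs <;> positivity
  · intro k; positivity
  · refine Summable.of_nonneg_of_le hu (fun k => ?_)
      ((Real.summable_pow_div_factorial (h ^ 4)).mul_right ((Real.sqrt (2 * Real.pi * (σ ^ 2 * h ^ 4)))⁻¹))
    refine mul_le_mul_of_nonneg_left ?_ (by positivity)
    unfold gauss
    refine mul_le_of_le_one_right (by positivity) (Real.exp_le_one_iff.2 ?_)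
    rw [neg_div]
    exact neg_nonpos.2 (by positivity)
  · intro k
    simp only [KK, JJ]
    rw [show σ ^ 2 * h ^ 4 = (σ * h ^ 2) ^ 2 by ring, gauss_scale_s11 _ _ (by positivity)]
    set z := (x - θ * k) / (σ * h ^ 2) with hz
    have hy : x - θ * k = z * (σ * h ^ 2) := by rw [hz]; field_simp
    rw [hy]
    have hc := coef k h (z ^ 2 / σ ^ 2) (((z ^ 2 - 1) / σ) ^ 4) h0 h1 (by positivity) (by positivity)
    have hg : 0 ≤ (k.factorial : ℝ)⁻¹ * ((σ * h ^ 2)⁻¹ * gauss 1 z) :=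
      mul_nonneg (by positivity) (mul_nonneg (by positivity) (gauss_nonneg _ _))
    have hc' := mul_le_mul_of_nonneg_left hc hg
    have r1 : h * ((k:ℝ) * (z * (σ * h ^ 2)) / (σ * h ^ 2) ^ 2) ^ 2
      = (k:ℝ) ^ 2 * (z ^ 2 / σ ^ 2) / h ^ 3 := by field_simp
    have r2 : (z * (σ * h ^ 2)) ^ 2 / (σ ^ 3 * h ^ 4) - 1 / σ = (z ^ 2 - 1) / σ := by field_simp
    rw [r1, r2]
    calc _ = _ := by ring
      _ ≤ _ := hc'
      _ = _ := by ring
  · intro j k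
    refine young _ _ h h0 _ ?_
    by_cases hj : j = 0
    · left; simp [hj]
    · right; simp [hj]

lemma KK_nonneg (σ θ h : ℝ) (hσ : 0 < σ) (h0 : 0 < h) (k : ℕ) (x : ℝ) : 0 ≤ KK σ θ h k x := by
  unfold KK
  have := JJ_nonneg σ ((x - θ * k) / (σ * h ^ 2))
  positivity

lemma KK_int (σ θ h : ℝ) (hσ : 0 < σ) (h0 : 0 < h) (k : ℕ) : Integrable (KK σ θ h k) := by
  have hc : σ * h ^ 2 ≠ 0 := by positivity
  exact ((((JJ_int σ).comp_div hc).comp_sub_right (θ * k)).const_mul _).const_mul _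

lemma KK_integral (σ θ h : ℝ) (hσ : 0 < σ) (h0 : 0 < h) (k : ℕ) :
    ∫ x, KK σ θ h k x = 4 ^ k / (k.factorial : ℝ) * (h * ∫ z, JJ σ z) := by
  have hc : 0 < σ * h ^ 2 := by positivity
  unfold KK
  rw [integral_const_mul, integral_const_mul,
    integral_sub_right_eq_self (fun x => JJ σ (x / (σ * h ^ 2))), Measure.integral_comp_div,
    abs_of_pos hc, smul_eq_mul, inv_mul_cancel_left₀ hc.ne', mul_assoc]

lemma final_bound (σ θ h : ℝ) (hσ : 0 < σ) (h0 : 0 < h) (f : ℝ → ℝ)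
    (hf : ∀ x, (Summable fun k => KK σ θ h k x) → |f x| ≤ ∑' k, KK σ θ h k x) :
    |∫ x, f x| ≤ (∑' k : ℕ, (4:ℝ) ^ k / (k.factorial : ℝ)) * (h * ∫ z, JJ σ z) := by
  have hJ : 0 ≤ ∫ z, JJ σ z := integral_nonneg (JJ_nonneg σ)
  have hR : 0 ≤ (∑' k : ℕ, (4:ℝ) ^ k / (k.factorial : ℝ)) * (h * ∫ z, JJ σ z) :=
    mul_nonneg (tsum_nonneg fun k => by positivity) (by positivity)
  have key : ‖∫ x, f x‖ₑ
      ≤ ENNReal.ofReal ((∑' k : ℕ, (4:ℝ) ^ k / (k.factorial : ℝ)) * (h * ∫ z, JJ σ z)) := by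
    calc ‖∫ x, f x‖ₑ ≤ ∫⁻ x, ‖f x‖ₑ := enorm_integral_le_lintegral_enorm _
      _ ≤ ∫⁻ x, ∑' k, ENNReal.ofReal (KK σ θ h k x) := by
        refine lintegral_mono fun x => ?_
        by_cases ht : ∑' k, ENNReal.ofReal (KK σ θ h k x) = ⊤
        · simp only [ht]; exact le_top
        · have hs := ENNReal.summable_toReal ht
          simp only [ENNReal.toReal_ofReal (KK_nonneg σ θ h hσ h0 _ x)] at hs
          simp only
          rw [← ENNReal.ofReal_tsum_of_nonneg (fun k => KK_nonneg σ θ h hσ h0 k x) hs,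
            Real.enorm_eq_ofReal_abs]
          exact ENNReal.ofReal_le_ofReal (hf x hs)
      _ = ∑' k, ∫⁻ x, ENNReal.ofReal (KK σ θ h k x) :=
        lintegral_tsum fun k => (KK_int σ θ h hσ h0 k).aemeasurable.ennreal_ofReal
      _ = ∑' k : ℕ, ENNReal.ofReal (4 ^ k / (k.factorial : ℝ) * (h * ∫ z, JJ σ z)) := by
        congr 1; ext k
        rw [← KK_integral σ θ h hσ h0 k, ofReal_integral_eq_lintegral_ofReal
          (KK_int σ θ h hσ h0 k) (Eventually.of_forall (KK_nonneg σ θ h hσ h0 k))]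
      _ = _ := by
        rw [← ENNReal.ofReal_tsum_of_nonneg (fun k => by positivity)
          ((Real.summable_pow_div_factorial 4).mul_right _), tsum_mul_right]
  rw [Real.enorm_eq_ofReal_abs] at key
  exact (ENNReal.ofReal_le_ofReal_iff hR).1 key

/-- Theorem 5.2, eq. Isa_Y=Poisson with β = 2: the cross (σ,θ) Fisher information of a
Brownian motion plus Poisson process model tends to 0 as Δ → 0. -/
theorem stmt_11 (σ θ : ℝ) (hσ : 0 < σ) (hθ : 0 < θ) :
    Tendsto (fun Δ : ℝ =>
        ∫ x : ℝ,
          (Real.exp (-Δ) * ∑' k : ℕ, (Δ ^ k / (k.factorial : ℝ)) *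
              (gauss (σ ^ 2 * Δ) (x - θ * k) * ((x - θ * k) ^ 2 / (σ ^ 3 * Δ) - 1 / σ))) *
          (Real.exp (-Δ) * ∑' k : ℕ, (Δ ^ k / (k.factorial : ℝ)) *
              (gauss (σ ^ 2 * Δ) (x - θ * k) * ((k : ℝ) * (x - θ * k) / (σ ^ 2 * Δ)))) /
          (Real.exp (-Δ) * ∑' k : ℕ, (Δ ^ k / (k.factorial : ℝ)) *
              gauss (σ ^ 2 * Δ) (x - θ * k)))
      (𝓝[>] 0) (𝓝 0) := by
  have hlim : Tendsto (fun Δ : ℝ => (∑' k : ℕ, (4:ℝ) ^ k / (k.factorial : ℝ)) *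
      (Δ ^ (1/4 : ℝ) * ∫ z, JJ σ z)) (𝓝[>] 0) (𝓝 0) := by
    have h : Tendsto (fun Δ : ℝ => Δ ^ (1/4 : ℝ)) (𝓝[>] 0) (𝓝 0) := by
      have := (Real.continuousAt_rpow_const 0 (1/4 : ℝ) (Or.inr (by norm_num))).tendsto
      rw [Real.zero_rpow (by norm_num)] at this
      exact this.mono_left nhdsWithin_le_nhds
    simpa using (h.mul_const (∫ z, JJ σ z)).const_mul (∑' k : ℕ, (4:ℝ) ^ k / (k.factorial : ℝ))
  refine squeeze_zero_norm' ?_ hlim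
  filter_upwards [Ioo_mem_nhdsGT (zero_lt_one' ℝ)] with Δ hΔ
  obtain ⟨hΔ0, hΔ1⟩ := hΔ
  have h0 : 0 < Δ ^ (1/4 : ℝ) := Real.rpow_pos_of_pos hΔ0 _
  have h1 : Δ ^ (1/4 : ℝ) ≤ 1 := Real.rpow_le_one hΔ0.le hΔ1.le (by norm_num)
  have h4 : (Δ ^ (1/4 : ℝ)) ^ 4 = Δ := by
    rw [← Real.rpow_natCast, ← Real.rpow_mul hΔ0.le]; norm_num
  rw [Real.norm_eq_abs]
  refine final_bound σ θ (Δ ^ (1/4 : ℝ)) hσ h0 _ fun x hx => ?_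
  have hp := ptwise σ θ (Δ ^ (1/4 : ℝ)) x hσ h0 h1 hx
  rw [h4] at hp
  refine le_trans ?_ hp
  have he : Real.exp (-Δ) ≠ 0 := (Real.exp_pos _).ne'
  have he1 : Real.exp (-Δ) ≤ 1 := Real.exp_le_one_iff.2 (by linarith)
  have alg : ∀ a b c : ℝ, |(Real.exp (-Δ) * a) * (Real.exp (-Δ) * b) / (Real.exp (-Δ) * c)|
      ≤ |a * b / c| := by
    intro a b c
    have : (Real.exp (-Δ) * a) * (Real.exp (-Δ) * b) / (Real.exp (-Δ) * c)
        = Real.exp (-Δ) * (a * b / c) := by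
      rw [mul_assoc, mul_div_mul_left _ _ he]; ring
    rw [this, abs_mul, abs_of_pos (Real.exp_pos _)]
    exact mul_le_of_le_one_left (abs_nonneg _) he1
  exact alg _ _ _
end

section
/- Let σ > 0, θ > 0, λ > 0, and let μ be a probability measure on ℝ with a continuously differentiable density f satisfying f(u) > 0 for all u, lim_{|u|→∞} u·f(u) = 0 and sup_u |f′(u)|·(1 + |u|) < ∞, and such that L = ∫ (u·f′(u) + f(u))²/f(u) du < ∞. Let μ_k denote the k-fold convolution power of μ, with μ₀ = δ₀. For Δ > 0 define p_Δ(x) = e^{−λΔ} Σ_{k=0}^∞ ((λΔ)^k/k!) ∫ φ_{σ²Δ}(x − θu) dμ_k(u) and D_Δ(x) = e^{−λΔ} Σ_{k=0}^∞ ((λΔ)^k/k!) ∫ φ_{σ²Δ}(x − θu) · u(x − θu)/(σ²Δ) dμ_k(u) (the θ-derivative of p_Δ). Then lim_{Δ→0} (1/Δ) ∫ D_Δ(x)²/p_Δ(x) dx = λ·L/θ². -/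
open MeasureTheory Filter Topology

/-- k-fold convolution power of a measure on ℝ (with `convPow μ 0 = δ₀`). -/
noncomputable def convPow (μ : Measure ℝ) : ℕ → Measure ℝ
  | 0 => Measure.dirac 0
  | n + 1 => Measure.map (fun p : ℝ × ℝ => p.1 + p.2) ((convPow μ n).prod μ)

section GaussFacts

lemma gauss_continuous (v : ℝ) : Continuous (gauss v) := by
  unfold gauss; fun_prop

lemma gauss_eq_pdf {v : ℝ} (hv : 0 < v) :
    gauss v = ProbabilityTheory.gaussianPDFReal 0 ⟨v, hv.le⟩ := by
  funext x
  simp [gauss, ProbabilityTheory.gaussianPDFReal]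
  rfl

lemma gauss_integrable {v : ℝ} (hv : 0 < v) : Integrable (gauss v) := by
  rw [gauss_eq_pdf hv]; exact ProbabilityTheory.integrable_gaussianPDFReal _ _

lemma gauss_integral {v : ℝ} (hv : 0 < v) : ∫ x, gauss v x = 1 := by
  rw [gauss_eq_pdf hv]
  refine ProbabilityTheory.integral_gaussianPDFReal_eq_one 0 ?_
  intro h
  have : v = 0 := congrArg NNReal.toReal h
  linarith

lemma gauss_hasDerivAt {v : ℝ} (hv : 0 < v) (x : ℝ) :
    HasDerivAt (gauss v) (-(gauss v x * (x / v))) x := by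
  unfold gauss
  have h1 : HasDerivAt (fun x : ℝ => -(x ^ 2) / (2 * v)) (-(x / v)) x := by
    have := ((hasDerivAt_pow 2 x).neg.div_const (2 * v))
    refine this.congr_deriv ?_
    field_simp
    norm_num
  have := (h1.exp).const_mul (Real.sqrt (2 * Real.pi * v))⁻¹
  refine this.congr_deriv ?_
  ring

lemma gauss_sq_bound {v : ℝ} (hv : 0 < v) (x : ℝ) :
    x ^ 2 * gauss v x ≤ 2 * v * (Real.sqrt (2 * Real.pi * v))⁻¹ := by
  unfold gauss
  have h := Real.add_one_le_exp (x ^ 2 / (2 * v))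
  have h2 : Real.exp (-(x ^ 2) / (2 * v)) * Real.exp (x ^ 2 / (2 * v)) = 1 := by
    rw [← Real.exp_add]; simp [neg_div]
  have h3 : x ^ 2 / (2 * v) * Real.exp (-(x ^ 2) / (2 * v)) ≤ 1 := by
    rw [← h2, mul_comm]
    gcongr
    linarith
  have h4 : x ^ 2 * Real.exp (-(x ^ 2) / (2 * v)) ≤ 2 * v := by
    have : x ^ 2 / (2 * v) * Real.exp (-(x ^ 2) / (2 * v))
      = x ^ 2 * Real.exp (-(x ^ 2) / (2 * v)) / (2 * v) := by ring
    rw [this, div_le_one (by positivity)] at h3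
    exact h3
  have h5 : 0 ≤ (Real.sqrt (2 * Real.pi * v))⁻¹ := by positivity
  nlinarith [mul_le_mul_of_nonneg_right h4 h5]

lemma gauss_le {v : ℝ} (hv : 0 < v) (x : ℝ) :
    gauss v x ≤ (Real.sqrt (2 * Real.pi * v))⁻¹ := by
  unfold gauss
  have : Real.exp (-(x ^ 2) / (2 * v)) ≤ 1 := by
    rw [Real.exp_le_one_iff]
    have : 0 ≤ x ^ 2 / (2 * v) := by positivity
    rw [neg_div]; linarith
  have h5 : 0 ≤ (Real.sqrt (2 * Real.pi * v))⁻¹ := by positivity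
  nlinarith

/-- the derivative kernel -/
noncomputable def gaussD (v x : ℝ) : ℝ := gauss v x * (x / v)

lemma gaussD_continuous (v : ℝ) : Continuous (gaussD v) := by
  unfold gaussD
  exact (gauss_continuous v).mul (by fun_prop)

lemma gaussD_integrable {v : ℝ} (hv : 0 < v) : Integrable (gaussD v) := by
  have h := (integrable_mul_exp_neg_mul_sq (b := 1 / (2 * v)) (by positivity)).const_mul
    ((Real.sqrt (2 * Real.pi * v))⁻¹ / v)
  refine h.congr (Eventually.of_forall fun x => ?_)
  simp only [gaussD, gauss]
  have : -(1 / (2 * v)) * x ^ 2 = -(x ^ 2) / (2 * v) := by ring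
  rw [this]; ring

/-- polynomially weighted bounds -/
lemma gaussD_bounds {v : ℝ} (hv : 0 < v) : ∃ C, 0 ≤ C ∧ (∀ x, |gaussD v x| ≤ C) ∧
    ∀ x, |x * gaussD v x| ≤ C := by
  set c := (Real.sqrt (2 * Real.pi * v))⁻¹ with hc
  have hc0 : 0 ≤ c := by positivity
  refine ⟨(c + 2 * v * c) / v, by positivity, fun x => ?_, fun x => ?_⟩
  · have h1 := gauss_sq_bound hv x
    have h2 := gauss_le hv x
    have h0 := gauss_nonneg v x
    rw [← hc] at h1 h2
    have : |gaussD v x| = gauss v x * |x| / v := by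
      rw [gaussD, abs_mul, abs_div, abs_of_nonneg h0, abs_of_pos hv]; ring
    rw [this]
    gcongr
    have h3 : |x| ≤ 1 + x ^ 2 := by
      rw [← sq_abs]; nlinarith [sq_nonneg (|x| - 1), abs_nonneg x]
    nlinarith
  · have h1 := gauss_sq_bound hv x
    have h0 := gauss_nonneg v x
    rw [← hc] at h1
    have : |x * gaussD v x| = x ^ 2 * gauss v x / v := by
      rw [gaussD, abs_of_nonneg]
      · ring
      · have : x * (gauss v x * (x / v)) = x ^ 2 * gauss v x / v := by ring
        rw [this]; positivity
    rw [this]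
    gcongr
    linarith

lemma integral_shift_scale {θ : ℝ} (hθ : 0 < θ) (ψ : ℝ → ℝ) (x : ℝ) :
    ∫ u, ψ (x - θ * u) = (∫ u, ψ u) / θ := by
  have h := Measure.integral_comp_mul_left (fun y => ψ (x - y)) θ
  rw [h, integral_sub_left_eq_self ψ volume x, abs_of_pos (inv_pos.2 hθ), smul_eq_mul]
  ring

lemma integrable_shift_scale {θ : ℝ} (hθ : 0 < θ) {ψ : ℝ → ℝ} (hψ : Integrable ψ) (x : ℝ) :
    Integrable (fun u => ψ (x - θ * u)) := by
  have h := hψ.comp_sub_left x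
  exact h.comp_mul_left' hθ.ne'

/-- approximate identity -/
lemma gauss_approx {θ : ℝ} (hθ : 0 < θ) {g : ℝ → ℝ} (hg : Continuous g) {B : ℝ}
    (hB : ∀ u, |g u| ≤ B) (x : ℝ) :
    Tendsto (fun v => ∫ u, gauss v (x - θ * u) * g u) (𝓝[>] 0) (𝓝 (g (x / θ) / θ)) := by
  have key : ∀ v, 0 < v → ∫ u, gauss v (x - θ * u) * g u =
      (∫ z, gauss 1 z * g ((x - Real.sqrt v * z) / θ)) / θ := by
    intro v hv
    have hs : 0 < Real.sqrt v := Real.sqrt_pos.2 hv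
    have h1 := integral_shift_scale hθ (fun y => gauss v y * g ((x - y) / θ)) x
    have h2 : ∀ u, (x - (x - θ * u)) / θ = u := by intro u; field_simp; ring
    simp only [h2] at h1
    rw [h1]
    congr 1
    have h3 := Measure.integral_comp_mul_left (fun y => gauss v y * g ((x - y) / θ)) (Real.sqrt v)
    have h4 : ∀ z, gauss 1 z = Real.sqrt v * gauss v (Real.sqrt v * z) := by
      intro z
      unfold gauss
      rw [Real.sqrt_mul (by positivity) v, mul_pow, Real.sq_sqrt hv.le]
      have : -(v * z ^ 2) / (2 * v) = -(z ^ 2) / (2 * 1) := by field_simp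
      rw [this, mul_one]
      field_simp
    simp only [h4, mul_assoc]
    rw [integral_const_mul, h3, abs_of_pos (inv_pos.2 hs), smul_eq_mul]
    field_simp
  have lim : Tendsto (fun v => (∫ z, gauss 1 z * g ((x - Real.sqrt v * z) / θ)) / θ) (𝓝[>] 0)
      (𝓝 ((∫ z, gauss 1 z * g (x / θ)) / θ)) := by
    refine Tendsto.div_const ?_ _
    refine tendsto_integral_filter_of_dominated_convergence (fun z => gauss 1 z * B) ?_ ?_ ?_ ?_
    · refine Eventually.of_forall fun v => Continuous.aestronglyMeasurable ?_
      exact (gauss_continuous 1).mul (hg.comp (by fun_prop))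
    · refine Eventually.of_forall fun v => Eventually.of_forall fun z => ?_
      rw [norm_mul, Real.norm_eq_abs, Real.norm_eq_abs, abs_of_nonneg (gauss_nonneg _ _)]
      exact mul_le_mul_of_nonneg_left (hB _) (gauss_nonneg _ _)
    · exact (gauss_integrable one_pos).mul_const B
    · refine Eventually.of_forall fun z => ?_
      refine Tendsto.const_mul _ ?_
      have hc : Continuous (fun v : ℝ => g ((x - Real.sqrt v * z) / θ)) :=
        hg.comp (by fun_prop)
      have := hc.tendsto 0
      simp only [Real.sqrt_zero, zero_mul, sub_zero] at this
      exact this.mono_left nhdsWithin_le_nhds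
  rw [integral_mul_const, gauss_integral one_pos, one_mul] at lim
  refine lim.congr' ?_
  filter_upwards [self_mem_nhdsWithin] with v hv
  exact (key v hv).symm

/-- Gaussian kernel off the origin vanishes faster than `v`. -/
lemma gauss_div_tendsto {x : ℝ} (hx : x ≠ 0) :
    Tendsto (fun v => gauss v x / v) (𝓝[>] 0) (𝓝 0) := by
  -- exp(-t) ≤ 2 / t^2
  have hb : ∀ v, 0 < v → gauss v x / v ≤
      8 / x ^ 4 * (Real.sqrt (2 * Real.pi))⁻¹ * Real.sqrt v := by
    intro v hv
    have hs : 0 < Real.sqrt v := Real.sqrt_pos.2 hv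
    have hx2 : 0 < x ^ 2 := by positivity
    set t := x ^ 2 / (2 * v) with ht
    have ht0 : 0 < t := by positivity
    have h1 : t ^ 2 / 2 ≤ Real.exp t := by
      have := Real.quadratic_le_exp_of_nonneg ht0.le
      linarith
    have h2 : Real.exp (-(x ^ 2) / (2 * v)) ≤ 2 / t ^ 2 := by
      rw [neg_div, ← ht, Real.exp_neg]
      rw [inv_le_comm₀ (Real.exp_pos _) (by positivity)]
      rw [inv_div]; exact h1
    unfold gauss
    calc (Real.sqrt (2 * Real.pi * v))⁻¹ * Real.exp (-(x ^ 2) / (2 * v)) / v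
        ≤ (Real.sqrt (2 * Real.pi * v))⁻¹ * (2 / t ^ 2) / v := by gcongr
      _ = _ := by
        rw [Real.sqrt_mul (by positivity) v, ht]
        have : v = Real.sqrt v ^ 2 := (Real.sq_sqrt hv.le).symm
        field_simp
        rw [← this]
        ring
  have hlim : Tendsto (fun v => 8 / x ^ 4 * (Real.sqrt (2 * Real.pi))⁻¹ * Real.sqrt v)
      (𝓝[>] 0) (𝓝 0) := by
    have hc : Continuous (fun v => 8 / x ^ 4 * (Real.sqrt (2 * Real.pi))⁻¹ * Real.sqrt v) := by
      fun_prop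
    have := hc.tendsto 0
    simp only [Real.sqrt_zero, mul_zero] at this
    exact this.mono_left nhdsWithin_le_nhds
  refine squeeze_zero' ?_ ?_ hlim
  · filter_upwards [self_mem_nhdsWithin] with v hv
    exact div_nonneg (gauss_nonneg _ _) (le_of_lt hv)
  · filter_upwards [self_mem_nhdsWithin] with v hv
    exact hb v hv

end GaussFacts

/-- Bookkeeping of the facts on the jump law which are used below; `s` is the score. -/
structure GoodJump (f : ℝ → ℝ) (μ : Measure ℝ) (s : ℝ → ℝ) (B L : ℝ) : Prop where
  fpos : ∀ u, 0 < f u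
  fmeas : Measurable f
  hμ : μ = (volume : Measure ℝ).withDensity (fun u => ENNReal.ofReal (f u))
  smeas : Measurable s
  fB : ∀ u, |(1 : ℝ)| * f u ≤ B
  uB : ∀ u, |u| * f u ≤ B
  sB : ∀ u, |s u| * f u ≤ B
  mean : ∫ u, s u ∂μ = 0
  sLp : MemLp s 2 μ
  sq : ∫ u, s u ^ 2 ∂μ = L
  ibp : ∀ θ v x : ℝ, 0 < θ → 0 < v → ∫ u, gaussD v (x - θ * u) * u ∂μ =
    -(1 / θ) * ∫ u, gauss v (x - θ * u) * s u ∂μ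

/-- joint law of the sum of jumps and of the sum of the scores -/
noncomputable def jointPow (μ : Measure ℝ) (s : ℝ → ℝ) : ℕ → Measure (ℝ × ℝ)
  | 0 => Measure.dirac (0, 0)
  | n + 1 => Measure.map (fun p : (ℝ × ℝ) × ℝ => (p.1.1 + p.2, p.1.2 + s p.2))
      ((jointPow μ s n).prod μ)

lemma integral_dens {f : ℝ → ℝ} {μ : Measure ℝ} (hpos : ∀ u, 0 < f u) (hm : Measurable f)
    (hμ : μ = (volume : Measure ℝ).withDensity (fun u => ENNReal.ofReal (f u))) (F : ℝ → ℝ) :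
    ∫ u, F u ∂μ = ∫ u, F u * f u := by
  rw [hμ, integral_withDensity_eq_integral_toReal_smul (by fun_prop) (by simp)]
  refine integral_congr_ae (Eventually.of_forall fun u => ?_)
  simp [ENNReal.toReal_ofReal (hpos u).le, mul_comm]

lemma integrable_dens {f : ℝ → ℝ} {μ : Measure ℝ} (hpos : ∀ u, 0 < f u) (hm : Measurable f)
    (hμ : μ = (volume : Measure ℝ).withDensity (fun u => ENNReal.ofReal (f u))) (F : ℝ → ℝ) :
    Integrable F μ ↔ Integrable (fun u => F u * f u) := by
  rw [hμ, integrable_withDensity_iff_integrable_smul' (by fun_prop) (by simp)]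
  refine integrable_congr (Eventually.of_forall fun u => ?_)
  simp [ENNReal.toReal_ofReal (hpos u).le, mul_comm]

section Joint

variable {f : ℝ → ℝ} {μ : Measure ℝ} {s : ℝ → ℝ} {B L : ℝ}

lemma jointMap_meas (hs : Measurable s) :
    Measurable (fun p : (ℝ × ℝ) × ℝ => (p.1.1 + p.2, p.1.2 + s p.2)) := by
  fun_prop

lemma jointPow_prob [IsProbabilityMeasure μ] (hs : Measurable s) (k : ℕ) :
    IsProbabilityMeasure (jointPow μ s k) := by
  induction k with
  | zero => unfold jointPow; infer_instance
  | succ n ih =>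
    unfold jointPow
    exact Measure.isProbabilityMeasure_map (jointMap_meas hs).aemeasurable

lemma jointPow_fst [IsProbabilityMeasure μ] (hs : Measurable s) (k : ℕ) :
    Measure.map Prod.fst (jointPow μ s k) = convPow μ k := by
  induction k with
  | zero =>
    unfold jointPow convPow
    rw [Measure.map_dirac' measurable_fst]
  | succ n ih =>
    have := jointPow_prob (μ := μ) hs n
    unfold jointPow convPow
    rw [← ih, Measure.map_map measurable_fst (jointMap_meas hs)]
    have h2 : ((Measure.map Prod.fst (jointPow μ s n)).prod μ) =
        Measure.map (Prod.map Prod.fst id) ((jointPow μ s n).prod μ) := by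
      rw [← Measure.map_prod_map _ _ measurable_fst measurable_id, Measure.map_id]
    rw [h2, Measure.map_map (by fun_prop) (by fun_prop)]
    rfl

lemma convPow_integral [IsProbabilityMeasure μ] (hs : Measurable s) (k : ℕ) (F : ℝ → ℝ)
    (hF : Continuous F) :
    ∫ u, F u ∂(convPow μ k) = ∫ p, F p.1 ∂(jointPow μ s k) := by
  rw [← jointPow_fst hs, integral_map measurable_fst.aemeasurable hF.aestronglyMeasurable]

lemma jointPow_succ_integral (hs : Measurable s) (k : ℕ) (F : ℝ × ℝ → ℝ) (hF : Measurable F) :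
    ∫ p, F p ∂(jointPow μ s (k + 1)) =
      ∫ p, F (p.1.1 + p.2, p.1.2 + s p.2) ∂((jointPow μ s k).prod μ) := by
  conv_lhs => unfold jointPow
  rw [integral_map (jointMap_meas hs).aemeasurable hF.aestronglyMeasurable]

lemma jointPow_moments [IsProbabilityMeasure μ] (h : GoodJump f μ s B L) (k : ℕ) :
    MemLp (fun p : ℝ × ℝ => p.2) 2 (jointPow μ s k) ∧ ∫ p, p.2 ∂(jointPow μ s k) = 0 ∧
      ∫ p, p.2 ^ 2 ∂(jointPow μ s k) = k * L := by
  induction k with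
  | zero =>
    refine ⟨?_, ?_, ?_⟩
    · unfold jointPow
      refine memLp_of_bounded (a := 0) (b := 0) ?_ (by fun_prop) _
      rw [ae_dirac_iff (measurableSet_preimage measurable_snd measurableSet_Icc)]
      simp
    · unfold jointPow; simp
    · unfold jointPow; simp
  | succ n ih =>
    obtain ⟨h1, h2, h3⟩ := ih
    have := jointPow_prob (μ := μ) h.smeas n
    have m1 : MemLp (fun p : (ℝ × ℝ) × ℝ => p.1.2) 2 ((jointPow μ s n).prod μ) :=
      h1.comp_fst μ
    have m2 : MemLp (fun p : (ℝ × ℝ) × ℝ => s p.2) 2 ((jointPow μ s n).prod μ) :=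
      h.sLp.comp_snd (jointPow μ s n)
    have i1 := h1.integrable (by norm_num)
    have i2 := h.sLp.integrable (by norm_num)
    refine ⟨?_, ?_, ?_⟩
    · conv => arg 3; unfold jointPow
      rw [memLp_map_measure_iff (by fun_prop) (jointMap_meas h.smeas).aemeasurable]
      exact m1.add m2
    · rw [jointPow_succ_integral h.smeas _ _ measurable_snd]
      simp only
      rw [integral_add (m1.integrable (by norm_num)) (m2.integrable (by norm_num)),
        integral_fun_fst (fun p : ℝ × ℝ => p.2), integral_fun_snd s, h2, h.mean]
      simp
    · rw [jointPow_succ_integral h.smeas _ _ (by fun_prop)]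
      have e : ∀ p : (ℝ × ℝ) × ℝ, (p.1.2 + s p.2) ^ 2 =
          p.1.2 ^ 2 + s p.2 ^ 2 + 2 * (p.1.2 * s p.2) := by intro p; ring
      simp only [e]
      have i12 : Integrable (fun p : (ℝ × ℝ) × ℝ => p.1.2 ^ 2 + s p.2 ^ 2)
        ((jointPow μ s n).prod μ) := m1.integrable_sq.add m2.integrable_sq
      rw [integral_add i12
        ((i1.mul_prod i2).const_mul 2), integral_add m1.integrable_sq m2.integrable_sq,
        integral_const_mul, integral_prod_mul (fun p : ℝ × ℝ => p.2) s,
        integral_fun_fst (fun p : ℝ × ℝ => p.2 ^ 2), integral_fun_snd (fun u => s u ^ 2), h2,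
        h3, h.sq]
      simp
      ring

/-- The main bound. -/
lemma kernel_bound [IsProbabilityMeasure μ] (h : GoodJump f μ s B L)
    (ν : Measure (ℝ × ℝ)) [IsProbabilityMeasure ν] {θ : ℝ} (hθ : 0 < θ)
    {ψ : ℝ → ℝ} (hψc : Continuous ψ) (hψ : Integrable ψ) {G : ℝ × ℝ → ℝ} (hGm : Measurable G)
    (hG : Integrable G ν) {q : ℝ → ℝ} (hqm : Measurable q) (hq : ∀ u, |q u| * f u ≤ B) (x : ℝ) :
    Integrable (fun p : (ℝ × ℝ) × ℝ => G p.1 * (ψ (x - θ * (p.1.1 + p.2)) * q p.2)) (ν.prod μ) ∧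
    ∫ p : (ℝ × ℝ) × ℝ, |G p.1 * (ψ (x - θ * (p.1.1 + p.2)) * q p.2)| ∂(ν.prod μ) ≤
      (∫ p, |G p| ∂ν) * (B * (∫ y, |ψ y|) / θ) := by
  have hB : ∀ y, Integrable (fun u => ψ (y - θ * u) * q u) μ ∧
      ∫ u, |ψ (y - θ * u) * q u| ∂μ ≤ B * (∫ y, |ψ y|) / θ := by
    intro y
    have hi := (integrable_shift_scale hθ hψ.abs y).const_mul B
    have hle : ∀ u, |ψ (y - θ * u) * q u| * f u ≤ B * |ψ (y - θ * u)| := by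
      intro u
      rw [abs_mul, mul_assoc, mul_comm B]
      exact mul_le_mul_of_nonneg_left (hq u) (abs_nonneg _)
    have hi2 : Integrable (fun u => |ψ (y - θ * u) * q u| * f u) := by
      refine hi.mono' ?_ (Eventually.of_forall fun u => ?_)
      · have := h.fmeas
        have := hψc.measurable
        exact Measurable.aestronglyMeasurable (by fun_prop)
      · rw [Real.norm_eq_abs, abs_of_nonneg (mul_nonneg (abs_nonneg _) (h.fpos u).le)]
        exact hle u
    constructor
    · rw [← integrable_norm_iff]
      · exact (integrable_dens h.fpos h.fmeas h.hμ _).2 hi2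
      · have := hψc.measurable
        exact Measurable.aestronglyMeasurable (by fun_prop)
    · rw [integral_dens h.fpos h.fmeas h.hμ]
      refine (integral_mono hi2 hi hle).trans_eq ?_
      rw [integral_const_mul, integral_shift_scale hθ (fun y => |ψ y|)]
      ring
  have hψm := hψc.measurable
  have hsm : Measurable (fun p : (ℝ × ℝ) × ℝ => G p.1 * (ψ (x - θ * (p.1.1 + p.2)) * q p.2)) := by
    fun_prop
  have hB' : ∀ a : ℝ × ℝ, Integrable (fun u => ψ (x - θ * (a.1 + u)) * q u) μ ∧
      ∫ u, |ψ (x - θ * (a.1 + u)) * q u| ∂μ ≤ B * (∫ y, |ψ y|) / θ := by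
    intro a
    have := hB (x - θ * a.1)
    have e : ∀ u, x - θ * a.1 - θ * u = x - θ * (a.1 + u) := by intro u; ring
    simpa only [e] using this
  have e1 : ∀ a : ℝ × ℝ, ∫ u, |G a * (ψ (x - θ * (a.1 + u)) * q u)| ∂μ =
      |G a| * ∫ u, |ψ (x - θ * (a.1 + u)) * q u| ∂μ := by
    intro a
    simp only [abs_mul (G a)]
    rw [integral_const_mul]
  have hint : Integrable (fun p : (ℝ × ℝ) × ℝ => G p.1 * (ψ (x - θ * (p.1.1 + p.2)) * q p.2))
      (ν.prod μ) := by
    rw [integrable_prod_iff hsm.aestronglyMeasurable]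
    constructor
    · exact Eventually.of_forall fun a => (hB' a).1.const_mul (G a)
    · simp only [Real.norm_eq_abs]
      refine (hG.abs.mul_const (B * (∫ y, |ψ y|) / θ)).mono' ?_ (Eventually.of_forall fun a => ?_)
      · exact hsm.abs.aestronglyMeasurable.integral_prod_right'
      · rw [e1, Real.norm_eq_abs, abs_of_nonneg (by positivity)]
        exact mul_le_mul_of_nonneg_left (hB' a).2 (abs_nonneg _)
  refine ⟨hint, ?_⟩
  rw [integral_prod _ hint.abs]
  have := hint.abs.integral_prod_left
  rw [← integral_mul_const]
  refine integral_mono this (hG.abs.mul_const _) fun a => ?_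
  simp only
  rw [e1]
  exact mul_le_mul_of_nonneg_left (hB' a).2 (abs_nonneg _)

lemma gaussD_weight {θ v : ℝ} (hθ : 0 < θ) (hv : 0 < v) (x : ℝ) :
    ∃ C, ∀ u, |gaussD v (x - θ * u) * u| ≤ C := by
  obtain ⟨C, hC, h1, h2⟩ := gaussD_bounds hv
  refine ⟨(|x| * C + C) / θ, fun u => ?_⟩
  have e : gaussD v (x - θ * u) * u =
      (x * gaussD v (x - θ * u) - (x - θ * u) * gaussD v (x - θ * u)) / θ := by
    field_simp; ring
  rw [e, abs_div, abs_of_pos hθ]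
  gcongr
  refine (abs_sub _ _).trans ?_
  rw [abs_mul]
  gcongr
  · exact h1 _
  · exact h2 _

lemma integrable_bdd {α : Type*} [MeasurableSpace α] {ν : Measure α} [IsFiniteMeasure ν]
    {F : α → ℝ} (hF : Measurable F) {C : ℝ} (hC : ∀ a, |F a| ≤ C) : Integrable F ν :=
  Integrable.of_bound hF.aestronglyMeasurable C (Eventually.of_forall hC)

/-- gauss times integrable -/
lemma integrable_gauss_mul {α : Type*} [MeasurableSpace α] {ν : Measure α}
    {F T : α → ℝ} (hF : Integrable F ν) (hT : Measurable T) {v : ℝ} (hv : 0 < v) :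
    Integrable (fun a => gauss v (T a) * F a) ν := by
  refine hF.bdd_mul (c := (Real.sqrt (2 * Real.pi * v))⁻¹) ?_ ?_
  · exact ((gauss_continuous v).measurable.comp hT).aestronglyMeasurable
  · refine Eventually.of_forall fun a => ?_
    rw [Real.norm_eq_abs, abs_of_nonneg (gauss_nonneg _ _)]
    exact gauss_le hv _

lemma joint_ibp [IsProbabilityMeasure μ] (h : GoodJump f μ s B L) {θ v : ℝ} (hθ : 0 < θ)
    (hv : 0 < v) (k : ℕ) : ∀ x : ℝ,
    ∫ p, gaussD v (x - θ * p.1) * p.1 ∂(jointPow μ s k) =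
    -(1 / θ) * ∫ p, gauss v (x - θ * p.1) * p.2 ∂(jointPow μ s k) := by
  induction k with
  | zero => intro x; unfold jointPow; simp
  | succ n ih =>
    intro x
    have hprob := jointPow_prob (μ := μ) h.smeas n
    have hgm := (gauss_continuous v).measurable
    have hgDm := (gaussD_continuous v).measurable
    have hsm := h.smeas
    obtain ⟨hLp, -, -⟩ := jointPow_moments h n
    have i1 := hLp.integrable (by norm_num)
    have i2 := h.sLp.integrable (by norm_num)
    rw [jointPow_succ_integral h.smeas _ _ (by fun_prop),
      jointPow_succ_integral h.smeas _ _ (by fun_prop)]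
    simp only
    obtain ⟨hu, -⟩ := kernel_bound h (jointPow μ s n) hθ (gaussD_continuous v)
      (gaussD_integrable hv) (G := fun _ => 1) measurable_const (integrable_const _)
      measurable_id h.uB x
    simp only [one_mul, id] at hu
    obtain ⟨C, hC⟩ := gaussD_weight hθ hv x
    have htot : Integrable (fun p : (ℝ × ℝ) × ℝ =>
        gaussD v (x - θ * (p.1.1 + p.2)) * (p.1.1 + p.2)) ((jointPow μ s n).prod μ) :=
      integrable_bdd (by fun_prop) (fun a => hC _)
    have hS : Integrable (fun p : (ℝ × ℝ) × ℝ =>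
        gaussD v (x - θ * (p.1.1 + p.2)) * p.1.1) ((jointPow μ s n).prod μ) := by
      refine (htot.sub hu).congr (Eventually.of_forall fun p => ?_)
      simp only [Pi.sub_apply]
      ring
    have j1 : Integrable (fun p : (ℝ × ℝ) × ℝ =>
        gauss v (x - θ * (p.1.1 + p.2)) * p.1.2) ((jointPow μ s n).prod μ) :=
      integrable_gauss_mul (i1.comp_fst μ) (by fun_prop) hv
    have j2 : Integrable (fun p : (ℝ × ℝ) × ℝ =>
        gauss v (x - θ * (p.1.1 + p.2)) * s p.2) ((jointPow μ s n).prod μ) :=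
      integrable_gauss_mul (i2.comp_snd (jointPow μ s n)) (by fun_prop) hv
    simp only [mul_add (gaussD _ _), mul_add (gauss _ _)]
    rw [integral_add hS hu, integral_add j1 j2, integral_prod_symm _ hS, integral_prod _ hu,
      integral_prod_symm _ j1, integral_prod _ j2, mul_add, ← integral_const_mul,
      ← integral_const_mul]
    congr 1
    · refine integral_congr_ae (Eventually.of_forall fun u => ?_)
      have e : ∀ a : ℝ, x - θ * (a + u) = (x - θ * u) - θ * a := by intro a; ring
      simp only [e]
      exact ih _
    · refine integral_congr_ae (Eventually.of_forall fun a => ?_)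
      have e : ∀ u : ℝ, x - θ * (a.1 + u) = (x - θ * a.1) - θ * u := by intro u; ring
      simp only [e]
      exact h.ibp θ v _ hθ hv

lemma joint_gauss_bound [IsProbabilityMeasure μ] (h : GoodJump f μ s B L) {θ v : ℝ} (hθ : 0 < θ)
    (hv : 0 < v) (k : ℕ) (x : ℝ) :
    |∫ p, gauss v (x - θ * p.1) ∂(jointPow μ s (k + 1))| ≤ B / θ := by
  have hprob := jointPow_prob (μ := μ) h.smeas k
  have hgm := (gauss_continuous v).measurable
  rw [jointPow_succ_integral h.smeas _ _ (by fun_prop)]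
  obtain ⟨hi, hb⟩ := kernel_bound h (jointPow μ s k) hθ (gauss_continuous v)
      (gauss_integrable hv) (G := fun _ => 1) measurable_const (integrable_const _)
      measurable_const h.fB x
  simp only [one_mul, mul_one, abs_of_nonneg (gauss_nonneg _ _), gauss_integral hv] at hb
  refine (abs_integral_le_integral_abs).trans ?_
  simp only [abs_of_nonneg (gauss_nonneg _ _)]
  refine hb.trans ?_
  simp

lemma joint_score_bound [IsProbabilityMeasure μ] (h : GoodJump f μ s B L) {θ v : ℝ} (hθ : 0 < θ)
    (hv : 0 < v) (k : ℕ) (x : ℝ) :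
    |∫ p, gauss v (x - θ * p.1) * p.2 ∂(jointPow μ s (k + 1))| ≤ (B / θ) * (2 + k * L) := by
  have hprob := jointPow_prob (μ := μ) h.smeas k
  have hgm := (gauss_continuous v).measurable
  have hsm := h.smeas
  obtain ⟨hLp, -, h2⟩ := jointPow_moments h k
  have i1 := hLp.integrable (by norm_num)
  have hB : 0 ≤ B := le_trans (by have := h.fpos 0; positivity) (h.fB 0)
  rw [jointPow_succ_integral h.smeas _ _ (by fun_prop)]
  obtain ⟨hi, hb⟩ := kernel_bound h (jointPow μ s k) hθ (gauss_continuous v)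
      (gauss_integrable hv) (G := fun p => p.2) measurable_snd i1
      measurable_const h.fB x
  obtain ⟨hi', hb'⟩ := kernel_bound h (jointPow μ s k) hθ (gauss_continuous v)
      (gauss_integrable hv) (G := fun _ => 1) measurable_const (integrable_const _)
      h.smeas h.sB x
  simp only [abs_of_nonneg (gauss_nonneg _ _), gauss_integral hv] at hb hb'
  have hE : ∫ p, |p.2| ∂(jointPow μ s k) ≤ 1 + k * L := by
    rw [← h2]
    have : (1 : ℝ) = ∫ p, (1 : ℝ) ∂(jointPow μ s k) := by simp
    rw [this, ← integral_add (integrable_const _) hLp.integrable_sq]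
    refine integral_mono i1.abs ((integrable_const _).add hLp.integrable_sq) fun p => ?_
    simp only
    rw [← sq_abs p.2]
    nlinarith [sq_nonneg (|p.2| - 1), abs_nonneg p.2]
  have e : ∀ p : (ℝ × ℝ) × ℝ, gauss v (x - θ * (p.1.1 + p.2)) * (p.1.2 + s p.2) =
      p.1.2 * (gauss v (x - θ * (p.1.1 + p.2)) * 1) +
      1 * (gauss v (x - θ * (p.1.1 + p.2)) * s p.2) := by intro p; ring
  simp only [e]
  rw [integral_add hi hi']
  have k1 := (abs_integral_le_integral_abs).trans hb
  have k2 := (abs_integral_le_integral_abs).trans hb'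
  refine (abs_add_le _ _).trans ((add_le_add k1 k2).trans ?_)
  have : 0 ≤ B / θ := by positivity
  simp only [abs_one, integral_const, mul_one, smul_eq_mul, probReal_univ, one_mul]
  nlinarith

end Joint

lemma bounded_of_cocompact {g : ℝ → ℝ} (hg : Continuous g)
    (h : Tendsto g (cocompact ℝ) (𝓝 0)) : ∃ M, ∀ u, |g u| ≤ M := by
  have h1 : ∀ᶠ u in cocompact ℝ, |g u| < 1 := by
    have := h.abs
    rw [abs_zero] at this
    exact this.eventually_lt_const one_pos
  obtain ⟨K, hK, hKs⟩ := mem_cocompact.1 h1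
  obtain ⟨C, hC⟩ := hK.exists_bound_of_continuousOn hg.continuousOn
  refine ⟨max C 1, fun u => ?_⟩
  by_cases hu : u ∈ K
  · exact le_max_of_le_left (hC u hu)
  · exact le_max_of_le_right (le_of_lt (hKs hu))

lemma goodJump_of (f : ℝ → ℝ) (hf : ContDiff ℝ 1 f) (hfpos : ∀ u, 0 < f u)
    (μ : Measure ℝ) [IsProbabilityMeasure μ]
    (hμ : μ = (volume : Measure ℝ).withDensity (fun u => ENNReal.ofReal (f u)))
    (hftail : Tendsto (fun u => u * f u) (cocompact ℝ) (𝓝 0))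
    (hf' : ∃ M, ∀ u, |deriv f u| * (1 + |u|) ≤ M)
    (hL : Integrable (fun u => (u * deriv f u + f u) ^ 2 / f u)) :
    ∃ B, GoodJump f μ (fun u => (u * deriv f u + f u) / f u) B
      (∫ u, (u * deriv f u + f u) ^ 2 / f u) := by
  have hfc : Continuous f := hf.continuous
  have hdc : Continuous (deriv f) := hf.continuous_deriv le_rfl
  obtain ⟨M, hM⟩ := hf'
  obtain ⟨M1, hM1⟩ := bounded_of_cocompact (by fun_prop) hftail
  obtain ⟨M2, hM2⟩ := (isCompact_Icc (a := (-1 : ℝ)) (b := 1)).exists_bound_of_continuousOn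
    hfc.continuousOn
  have hM0 : 0 ≤ M := le_trans (by positivity) (hM 0)
  have hM10 : 0 ≤ M1 := le_trans (by positivity) (hM1 0)
  have hM20 : 0 ≤ M2 := le_trans (by positivity) (hM2 0 (by simp))
  have ub : ∀ u, |u| * f u ≤ M1 := by
    intro u
    have := hM1 u
    rwa [abs_mul, abs_of_pos (hfpos u)] at this
  have fb : ∀ u, f u ≤ M1 + M2 := by
    intro u
    by_cases hu : |u| ≤ 1
    · have := hM2 u (abs_le.1 hu)
      rw [Real.norm_eq_abs, abs_of_pos (hfpos u)] at this
      linarith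
    · have := ub u
      nlinarith [hfpos u]
  have sf : ∀ u, (u * deriv f u + f u) / f u * f u = u * deriv f u + f u := by
    intro u
    exact div_mul_cancel₀ _ (hfpos u).ne'
  have gb : ∀ u, |u * deriv f u + f u| ≤ M + M1 + M2 := by
    intro u
    refine (abs_add_le _ _).trans ?_
    rw [abs_mul, abs_of_pos (hfpos u)]
    have := hM u
    have := fb u
    nlinarith [abs_nonneg (deriv f u), abs_nonneg u]
  have hsm : Measurable (fun u => (u * deriv f u + f u) / f u) := by
    have := hdc.measurable
    have := hfc.measurable
    fun_prop
  have sqf : ∀ u, ((u * deriv f u + f u) / f u) ^ 2 * f u = (u * deriv f u + f u) ^ 2 / f u := by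
    intro u
    have := (hfpos u).ne'
    field_simp
  have hLp : MemLp (fun u => (u * deriv f u + f u) / f u) 2 μ := by
    rw [memLp_two_iff_integrable_sq hsm.aestronglyMeasurable,
      integrable_dens hfpos hfc.measurable hμ]
    simpa only [sqf] using hL
  have hgi : Integrable (fun u => u * deriv f u + f u) := by
    have := (integrable_dens hfpos hfc.measurable hμ _).1 (hLp.integrable (by norm_num))
    simpa only [sf] using this
  have hder : ∀ u, HasDerivAt (fun u => u * f u) (u * deriv f u + f u) u := by
    intro u
    have h1 := (hasDerivAt_id u).mul ((hf.differentiable one_ne_zero) u).hasDerivAt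
    refine h1.congr_deriv ?_
    simp only [id]
    ring
  refine ⟨M + M1 + M2, ?_⟩
  refine ⟨hfpos, hfc.measurable, hμ, hsm, ?_, ?_, ?_, ?_, hLp, ?_, ?_⟩
  · intro u; have := fb u; rw [abs_one, one_mul]; linarith
  · intro u; have := ub u; linarith
  · intro u
    rw [← abs_of_pos (hfpos u), ← abs_mul, abs_of_pos (hfpos u), sf]
    exact gb u
  · rw [integral_dens hfpos hfc.measurable hμ]
    simp only [sf]
    rw [cocompact_eq_atBot_atTop, tendsto_sup] at hftail
    rw [integral_of_hasDerivAt_of_tendsto hder hgi hftail.1 hftail.2, sub_zero]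
  · rw [integral_dens hfpos hfc.measurable hμ]
    simp only [sqf]
  · intro θ v x hθ hv
    rw [integral_dens hfpos hfc.measurable hμ, integral_dens hfpos hfc.measurable hμ]
    simp only [mul_assoc, sf]
    have hu : ∀ u, HasDerivAt (fun u => gauss v (x - θ * u)) (θ * gaussD v (x - θ * u)) u := by
      intro u
      have h1 : HasDerivAt (fun u : ℝ => x - θ * u) (-θ) u := by
        simpa using ((hasDerivAt_id u).const_mul θ).const_sub x
      have h2 := (gauss_hasDerivAt hv (x - θ * u)).comp u h1
      refine h2.congr_deriv ?_
      unfold gaussD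
      ring
    have hgc := (gauss_continuous v)
    have hgDc := (gaussD_continuous v)
    have g1 := integrable_shift_scale hθ (gauss_integrable hv) x
    have g2 := (integrable_shift_scale hθ (gaussD_integrable hv) x).const_mul θ
    have I1 : Integrable ((fun u => gauss v (x - θ * u)) * fun u => u * deriv f u + f u) := by
      refine g1.mul_bdd (c := M + M1 + M2) ?_ (Eventually.of_forall fun u => gb u)
      exact Continuous.aestronglyMeasurable (by fun_prop)
    have I2 : Integrable ((fun u => θ * gaussD v (x - θ * u)) * fun u => u * f u) := by
      refine g2.mul_bdd (c := M1) ?_ (Eventually.of_forall fun u => hM1 u)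
      exact Continuous.aestronglyMeasurable (by fun_prop)
    have I3 : Integrable ((fun u => gauss v (x - θ * u)) * fun u => u * f u) := by
      refine g1.mul_bdd (c := M1) ?_ (Eventually.of_forall fun u => hM1 u)
      exact Continuous.aestronglyMeasurable (by fun_prop)
    have key := integral_mul_deriv_eq_deriv_mul_of_integrable (fun u _ => hu u)
      (fun u _ => hder u) I1 I2 I3
    rw [key]
    simp only [mul_assoc]
    rw [integral_const_mul]
    field_simp

/-- Poisson weights -/
noncomputable def pw (r : ℝ) (k : ℕ) : ℝ := Real.exp (-r) * (r ^ k / (k.factorial : ℝ))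

lemma pw_nonneg {r : ℝ} (hr : 0 ≤ r) (k : ℕ) : 0 ≤ pw r k := by
  unfold pw; positivity

lemma exp_hasSum (r : ℝ) : HasSum (fun k : ℕ => r ^ k / (k.factorial : ℝ)) (Real.exp r) := by
  rw [Real.exp_eq_exp_ℝ]
  exact NormedSpace.expSeries_div_hasSum_exp r

lemma pw_hasSum (r : ℝ) : HasSum (pw r) 1 := by
  have := (exp_hasSum r).mul_left (Real.exp (-r))
  rwa [← Real.exp_add, neg_add_cancel, Real.exp_zero] at this

lemma pw_mean (r : ℝ) : HasSum (fun k : ℕ => pw r k * k) r := by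
  rw [← hasSum_nat_add_iff' 1]
  have := (pw_hasSum r).mul_left r
  simp only [Finset.range_one, Finset.sum_singleton, Nat.cast_zero, mul_zero, sub_zero]
  rw [mul_one] at this
  refine this.congr_fun ?_
  intro k
  unfold pw
  rw [Nat.factorial_succ]
  push_cast
  have : (k.factorial : ℝ) ≠ 0 := by positivity
  have : (k : ℝ) + 1 ≠ 0 := by positivity
  field_simp
  ring

/-- compound Poisson mixture -/
noncomputable def mix (μ : Measure ℝ) (s : ℝ → ℝ) (r : ℝ) : Measure (ℝ × ℝ) :=
  Measure.sum (fun k => ENNReal.ofReal (pw r k) • jointPow μ s k)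

section Mix

variable {f : ℝ → ℝ} {μ : Measure ℝ} {s : ℝ → ℝ} {B L : ℝ}

lemma mix_hasSum {r : ℝ} (hr : 0 ≤ r) {F : ℝ × ℝ → ℝ} (hF : Integrable F (mix μ s r)) :
    HasSum (fun k => pw r k * ∫ p, F p ∂(jointPow μ s k)) (∫ p, F p ∂(mix μ s r)) := by
  have := hasSum_integral_measure hF
  simp only [integral_smul_measure, ENNReal.toReal_ofReal (pw_nonneg hr _), smul_eq_mul] at this
  exact this

lemma mix_integrable {r : ℝ} (hr : 0 ≤ r) {F : ℝ × ℝ → ℝ}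
    (hF : ∀ k, Integrable F (jointPow μ s k))
    (hS : Summable (fun k => pw r k * ∫ p, |F p| ∂(jointPow μ s k))) :
    Integrable F (mix μ s r) := by
  refine integrable_sum_measure (fun k => (hF k).smul_measure ENNReal.ofReal_ne_top) ?_
  simpa only [integral_smul_measure, ENNReal.toReal_ofReal (pw_nonneg hr _), smul_eq_mul,
    Real.norm_eq_abs] using hS

lemma mix_finite [IsProbabilityMeasure μ] (hs : Measurable s) {r : ℝ} (hr : 0 ≤ r) :
    IsFiniteMeasure (mix μ s r) := by
  have hp := fun k => jointPow_prob (μ := μ) hs k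
  have : Integrable (fun _ => (1 : ℝ)) (mix μ s r) := by
    refine mix_integrable hr (fun k => integrable_const _) ?_
    simpa using (pw_hasSum r).summable
  rw [integrable_const_iff] at this
  simpa using this

lemma mix_sq [IsProbabilityMeasure μ] (h : GoodJump f μ s B L) {r : ℝ} (hr : 0 ≤ r) :
    Integrable (fun p : ℝ × ℝ => p.2 ^ 2) (mix μ s r) ∧ ∫ p, p.2 ^ 2 ∂(mix μ s r) = r * L := by
  have h1 : HasSum (fun k => pw r k * ∫ p, p.2 ^ 2 ∂(jointPow μ s k)) (r * L) := by
    have := (pw_mean r).mul_right L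
    refine this.congr_fun ?_
    intro k
    rw [(jointPow_moments h k).2.2]
    ring
  have hi : Integrable (fun p : ℝ × ℝ => p.2 ^ 2) (mix μ s r) := by
    refine mix_integrable hr (fun k => (jointPow_moments h k).1.integrable_sq) ?_
    simpa only [abs_pow, sq_abs] using h1.summable
  exact ⟨hi, (mix_hasSum hr hi).unique h1⟩

lemma mix_memLp [IsProbabilityMeasure μ] (h : GoodJump f μ s B L) {r : ℝ} (hr : 0 ≤ r) :
    MemLp (fun p : ℝ × ℝ => p.2) 2 (mix μ s r) := by
  rw [memLp_two_iff_integrable_sq measurable_snd.aestronglyMeasurable]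
  exact (mix_sq h hr).1

/-- density -/
noncomputable def pMix (μ : Measure ℝ) (s : ℝ → ℝ) (θ r v x : ℝ) : ℝ :=
  ∫ p, gauss v (x - θ * p.1) ∂(mix μ s r)

/-- score numerator -/
noncomputable def nMix (μ : Measure ℝ) (s : ℝ → ℝ) (θ r v x : ℝ) : ℝ :=
  ∫ p, gauss v (x - θ * p.1) * p.2 ∂(mix μ s r)

lemma pMix_hasSum [IsProbabilityMeasure μ] (h : GoodJump f μ s B L) {θ r v : ℝ} (hr : 0 ≤ r)
    (hv : 0 < v) (x : ℝ) :
    HasSum (fun k => pw r k * ∫ p, gauss v (x - θ * p.1) ∂(jointPow μ s k))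
      (pMix μ s θ r v x) := by
  have := mix_finite (μ := μ) h.smeas hr
  refine mix_hasSum hr ?_
  have := integrable_gauss_mul (integrable_const (μ := mix μ s r) (1 : ℝ))
    (T := fun p : ℝ × ℝ => x - θ * p.1) (by fun_prop) hv
  simpa only [mul_one] using this

lemma nMix_hasSum [IsProbabilityMeasure μ] (h : GoodJump f μ s B L) {θ r v : ℝ} (hr : 0 ≤ r)
    (hv : 0 < v) (x : ℝ) :
    HasSum (fun k => pw r k * ∫ p, gauss v (x - θ * p.1) * p.2 ∂(jointPow μ s k))
      (nMix μ s θ r v x) := by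
  have := mix_finite (μ := μ) h.smeas hr
  refine mix_hasSum hr ?_
  exact integrable_gauss_mul ((mix_memLp h hr).integrable (by norm_num))
    (T := fun p : ℝ × ℝ => x - θ * p.1) (by fun_prop) hv

lemma pMix_eq [IsProbabilityMeasure μ] (h : GoodJump f μ s B L) {θ r v : ℝ} (hr : 0 ≤ r)
    (hv : 0 < v) (x : ℝ) :
    Real.exp (-r) * ∑' k : ℕ, (r ^ k / (k.factorial : ℝ)) *
      ∫ u, gauss v (x - θ * u) ∂(convPow μ k) = pMix μ s θ r v x := by
  rw [← tsum_mul_left, ← (pMix_hasSum h hr hv x).tsum_eq]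
  refine tsum_congr fun k => ?_
  rw [convPow_integral h.smeas k (fun u => gauss v (x - θ * u))
    ((gauss_continuous v).comp (by fun_prop)), pw]
  ring

lemma nMix_eq [IsProbabilityMeasure μ] (h : GoodJump f μ s B L) {θ r v : ℝ} (hθ : 0 < θ)
    (hr : 0 ≤ r) (hv : 0 < v) (x : ℝ) :
    Real.exp (-r) * ∑' k : ℕ, (r ^ k / (k.factorial : ℝ)) *
      ∫ u, gauss v (x - θ * u) * (u * (x - θ * u) / v) ∂(convPow μ k) =
      -(1 / θ) * nMix μ s θ r v x := by
  rw [← tsum_mul_left, ← (nMix_hasSum h hr hv x).tsum_eq, ← tsum_mul_left]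
  refine tsum_congr fun k => ?_
  have e : ∀ u, gauss v (x - θ * u) * (u * (x - θ * u) / v) = gaussD v (x - θ * u) * u := by
    intro u; unfold gaussD; ring
  simp only [e]
  rw [convPow_integral h.smeas k (fun u => gaussD v (x - θ * u) * u)
    (((gaussD_continuous v).comp (by fun_prop : Continuous fun u => x - θ * u)).mul continuous_id),
    pw]
  have := joint_ibp h hθ hv k x
  rw [this]
  ring

lemma mix_joint_int [IsProbabilityMeasure μ] (h : GoodJump f μ s B L) {θ r v : ℝ}
    (hr : 0 ≤ r) (hv : 0 < v) :
    Integrable (fun q : ℝ × (ℝ × ℝ) => gauss v (q.1 - θ * q.2.1) * q.2.2 ^ 2)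
      (volume.prod (mix μ s r)) ∧
    ∫ x, ∫ p, gauss v (x - θ * p.1) * p.2 ^ 2 ∂(mix μ s r) = r * L := by
  have := mix_finite (μ := μ) h.smeas hr
  have hgm := (gauss_continuous v).measurable
  have hm : Measurable (fun q : ℝ × (ℝ × ℝ) => gauss v (q.1 - θ * q.2.1) * q.2.2 ^ 2) := by
    fun_prop
  have e : ∀ p : ℝ × ℝ, ∫ x, gauss v (x - θ * p.1) * p.2 ^ 2 = p.2 ^ 2 := by
    intro p
    rw [integral_mul_const, integral_sub_right_eq_self (gauss v), gauss_integral hv, one_mul]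
  have hi : Integrable (fun q : ℝ × (ℝ × ℝ) => gauss v (q.1 - θ * q.2.1) * q.2.2 ^ 2)
      (volume.prod (mix μ s r)) := by
    rw [integrable_prod_iff' hm.aestronglyMeasurable]
    constructor
    · exact Eventually.of_forall fun p =>
        ((gauss_integrable hv).comp_sub_right (θ * p.1)).mul_const (p.2 ^ 2)
    · simp only [Real.norm_eq_abs, abs_mul, abs_of_nonneg (gauss_nonneg _ _),
        abs_pow, sq_abs, e]
      exact (mix_sq h hr).1
  refine ⟨hi, ?_⟩
  rw [integral_integral_swap (f := fun x (p : ℝ × ℝ) => gauss v (x - θ * p.1) * p.2 ^ 2) hi]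
  simp only [e]
  exact (mix_sq h hr).2

lemma mix_CS [IsProbabilityMeasure μ] (h : GoodJump f μ s B L) {θ r v : ℝ}
    (hr : 0 ≤ r) (hv : 0 < v) (x : ℝ) :
    nMix μ s θ r v x ^ 2 / pMix μ s θ r v x ≤
      ∫ p, gauss v (x - θ * p.1) * p.2 ^ 2 ∂(mix μ s r) := by
  have := mix_finite (μ := μ) h.smeas hr
  have hgm := (gauss_continuous v).measurable
  have hT : Measurable (fun p : ℝ × ℝ => x - θ * p.1) := by fun_prop
  have i0 : Integrable (fun p : ℝ × ℝ => gauss v (x - θ * p.1)) (mix μ s r) := by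
    simpa only [mul_one] using
      integrable_gauss_mul (integrable_const (μ := mix μ s r) (1 : ℝ)) hT hv
  have i1 := integrable_gauss_mul ((mix_memLp h hr).integrable (by norm_num)) hT hv
  have i2 := integrable_gauss_mul (mix_sq h hr).1 hT hv
  set N := nMix μ s θ r v x with hN
  set P := pMix μ s θ r v x with hP
  by_cases hP0 : P = 0
  · rw [hP0, div_zero]
    exact integral_nonneg fun p => mul_nonneg (gauss_nonneg _ _) (sq_nonneg _)
  have key : 0 ≤ ∫ p, gauss v (x - θ * p.1) * (p.2 - N / P) ^ 2 ∂(mix μ s r) :=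
    integral_nonneg fun p => mul_nonneg (gauss_nonneg _ _) (sq_nonneg _)
  have e : ∀ p : ℝ × ℝ, gauss v (x - θ * p.1) * (p.2 - N / P) ^ 2 =
      gauss v (x - θ * p.1) * p.2 ^ 2 - (2 * (N / P)) * (gauss v (x - θ * p.1) * p.2) +
      (N / P) ^ 2 * gauss v (x - θ * p.1) := by intro p; ring
  simp only [e] at key
  have i3 : Integrable (fun p : ℝ × ℝ => gauss v (x - θ * p.1) * p.2 ^ 2 -
      (2 * (N / P)) * (gauss v (x - θ * p.1) * p.2)) (mix μ s r) := i2.sub (i1.const_mul _)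
  rw [integral_add i3 (i0.const_mul _), integral_sub i2 (i1.const_mul _), integral_const_mul,
    integral_const_mul] at key
  change 0 ≤ _ - (2 * (N / P)) * N + (N / P) ^ 2 * P at key
  have e2 : (2 * (N / P)) * N - (N / P) ^ 2 * P = N ^ 2 / P := by
    field_simp; ring
  linarith

lemma mix_upper [IsProbabilityMeasure μ] (h : GoodJump f μ s B L) {θ r v : ℝ}
    (hr : 0 ≤ r) (hv : 0 < v) :
    Measurable (fun x => nMix μ s θ r v x ^ 2 / pMix μ s θ r v x) ∧
    Integrable (fun x => nMix μ s θ r v x ^ 2 / pMix μ s θ r v x) ∧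
    (∀ x, 0 ≤ nMix μ s θ r v x ^ 2 / pMix μ s θ r v x) ∧
    ∫ x, nMix μ s θ r v x ^ 2 / pMix μ s θ r v x ≤ r * L := by
  have := mix_finite (μ := μ) h.smeas hr
  have hgm := (gauss_continuous v).measurable
  have hmN : Measurable (fun x => nMix μ s θ r v x) := by
    have : Measurable (fun q : ℝ × (ℝ × ℝ) => gauss v (q.1 - θ * q.2.1) * q.2.2) := by fun_prop
    exact this.stronglyMeasurable.integral_prod_right'.measurable
  have hmP : Measurable (fun x => pMix μ s θ r v x) := by
    have : Measurable (fun q : ℝ × (ℝ × ℝ) => gauss v (q.1 - θ * q.2.1)) := by fun_prop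
    exact this.stronglyMeasurable.integral_prod_right'.measurable
  have hm : Measurable (fun x => nMix μ s θ r v x ^ 2 / pMix μ s θ r v x) := by fun_prop
  have h0 : ∀ x, 0 ≤ nMix μ s θ r v x ^ 2 / pMix μ s θ r v x := fun x =>
    div_nonneg (sq_nonneg _) (integral_nonneg fun p => gauss_nonneg _ _)
  obtain ⟨hi, hE⟩ := mix_joint_int (θ := θ) h hr hv
  have hi' := hi.integral_prod_left
  have hint : Integrable (fun x => nMix μ s θ r v x ^ 2 / pMix μ s θ r v x) := by
    refine hi'.mono' hm.aestronglyMeasurable (Eventually.of_forall fun x => ?_)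
    rw [Real.norm_eq_abs, abs_of_nonneg (h0 x)]
    exact mix_CS h hr hv x
  refine ⟨hm, hint, h0, ?_⟩
  rw [← hE]
  exact integral_mono hint hi' fun x => mix_CS h hr hv x

end Mix

lemma poisson_small {lam : ℝ} (hlam : 0 < lam) {a : ℝ → ℕ → ℝ} {ℓ C : ℝ} {P : ℝ → ℝ}
    (hP : ∀ Δ, 0 < Δ → HasSum (fun k => pw (lam * Δ) k * a Δ k) (P Δ))
    (h0 : Tendsto (fun Δ => a Δ 0 / Δ) (𝓝[>] 0) (𝓝 0))
    (h1 : Tendsto (fun Δ => a Δ 1) (𝓝[>] 0) (𝓝 ℓ))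
    (hb : ∀ Δ, 0 < Δ → ∀ k : ℕ, |a Δ (k + 1)| ≤ C * (k + 1)) :
    Tendsto (fun Δ => P Δ / Δ) (𝓝[>] 0) (𝓝 (lam * ℓ)) := by
  have hR : ∀ Δ, 0 < Δ → |P Δ - (pw (lam * Δ) 0 * a Δ 0 + pw (lam * Δ) 1 * a Δ 1)| ≤
      C * (lam * Δ) ^ 2 := by
    intro Δ hΔ
    have hr : 0 ≤ lam * Δ := by positivity
    have hC : 0 ≤ C := by
      have := (abs_nonneg _).trans (hb Δ hΔ 0)
      simpa using this
    have t := (hasSum_nat_add_iff' 2).2 (hP Δ hΔ)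
    rw [Finset.sum_range_succ, Finset.sum_range_one] at t
    have g := (pw_hasSum (lam * Δ)).mul_left (C * (lam * Δ) ^ 2)
    rw [mul_one] at g
    refine HasSum.norm_le_of_bounded t g fun k => ?_
    rw [Real.norm_eq_abs, abs_mul, abs_of_nonneg (pw_nonneg hr _)]
    have e : pw (lam * Δ) (k + 2) * (k + 2) = (lam * Δ) ^ 2 * pw (lam * Δ) k / (k + 1) := by
      unfold pw
      rw [Nat.factorial_succ, Nat.factorial_succ]
      push_cast
      have : (k.factorial : ℝ) ≠ 0 := by positivity
      have : (k : ℝ) + 1 ≠ 0 := by positivity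
      have : (k : ℝ) + 1 + 1 ≠ 0 := by positivity
      field_simp
      ring
    have e2 : pw (lam * Δ) (k + 2) * (k + 2) ≤ (lam * Δ) ^ 2 * pw (lam * Δ) k := by
      rw [e]
      refine div_le_self (mul_nonneg (sq_nonneg _) (pw_nonneg hr _)) ?_
      have : (0 : ℝ) ≤ k := by positivity
      linarith
    have e3 := hb Δ hΔ (k + 1)
    push_cast at e3
    calc pw (lam * Δ) (k + 2) * |a Δ (k + 2)|
        ≤ pw (lam * Δ) (k + 2) * (C * (k + 1 + 1)) :=
          mul_le_mul_of_nonneg_left e3 (pw_nonneg hr _)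
      _ = C * (pw (lam * Δ) (k + 2) * (k + 2)) := by ring
      _ ≤ C * ((lam * Δ) ^ 2 * pw (lam * Δ) k) := mul_le_mul_of_nonneg_left e2 hC
      _ = _ := by ring
  have hid : Tendsto (fun Δ : ℝ => Δ) (𝓝[>] 0) (𝓝 0) := tendsto_id.mono_left nhdsWithin_le_nhds
  have hE : Tendsto (fun Δ => Real.exp (-(lam * Δ))) (𝓝[>] 0) (𝓝 1) := by
    have hc : Continuous (fun Δ => Real.exp (-(lam * Δ))) := by fun_prop
    have := hc.tendsto 0
    simp only [mul_zero, neg_zero, Real.exp_zero] at this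
    exact this.mono_left nhdsWithin_le_nhds
  have hrem : Tendsto (fun Δ => (P Δ - (pw (lam * Δ) 0 * a Δ 0 + pw (lam * Δ) 1 * a Δ 1)) / Δ)
      (𝓝[>] 0) (𝓝 0) := by
    have hz : Tendsto (fun Δ => C * lam ^ 2 * Δ) (𝓝[>] 0) (𝓝 0) := by
      simpa using hid.const_mul (C * lam ^ 2)
    refine squeeze_zero_norm' ?_ hz
    filter_upwards [self_mem_nhdsWithin] with Δ hΔ
    have hΔ : 0 < Δ := hΔ
    rw [Real.norm_eq_abs, abs_div, abs_of_pos hΔ, div_le_iff₀ hΔ]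
    refine (hR Δ hΔ).trans_eq (by ring)
  have hm : Tendsto (fun Δ => Real.exp (-(lam * Δ)) * (a Δ 0 / Δ) +
      lam * (Real.exp (-(lam * Δ)) * a Δ 1)) (𝓝[>] 0) (𝓝 (1 * 0 + lam * (1 * ℓ))) :=
    (hE.mul h0).add ((hE.mul h1).const_mul lam)
  have := hrem.add hm
  simp only [mul_zero, zero_add, one_mul] at this
  refine this.congr' ?_
  filter_upwards [self_mem_nhdsWithin] with Δ hΔ
  have hΔ : 0 < Δ := hΔ
  unfold pw
  simp
  field_simp
  ring

lemma tendsto_of_fatou {F : ℝ → ℝ → ℝ} {H : ℝ → ℝ} {c : ℝ}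
    (hm : ∀ Δ, 0 < Δ → Measurable (F Δ)) (hi : ∀ Δ, 0 < Δ → Integrable (F Δ))
    (hn : ∀ Δ, 0 < Δ → ∀ x, 0 ≤ F Δ x) (hc : ∀ Δ, 0 < Δ → ∫ x, F Δ x ≤ c)
    (hH : Integrable H) (hH0 : ∀ x, 0 ≤ H x) (hHc : ∫ x, H x = c)
    (hl : ∀ᵐ x, Tendsto (fun Δ => F Δ x) (𝓝[>] 0) (𝓝 (H x))) :
    Tendsto (fun Δ => ∫ x, F Δ x) (𝓝[>] 0) (𝓝 c) := by
  rw [tendsto_order]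
  constructor
  · intro a ha
    rcases lt_or_ge a 0 with ha0 | ha0
    · filter_upwards [self_mem_nhdsWithin] with Δ hΔ
      exact ha0.trans_le (integral_nonneg (hn Δ hΔ))
    have hmeas : ∀ Δ, Measurable (fun x => if 0 < Δ then ENNReal.ofReal (F Δ x) else 0) := by
      intro Δ
      by_cases h : 0 < Δ
      · simp only [h, if_true]; exact (hm Δ h).ennreal_ofReal
      · simp only [h, if_false]; exact measurable_const
    have key := lintegral_liminf_le (μ := (volume : Measure ℝ)) (u := 𝓝[>] (0 : ℝ)) hmeas
    have e1 : ∫⁻ x, liminf (fun Δ : ℝ => if 0 < Δ then ENNReal.ofReal (F Δ x) else 0) (𝓝[>] 0) =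
        ENNReal.ofReal c := by
      rw [← hHc, ofReal_integral_eq_lintegral_ofReal hH (Eventually.of_forall hH0)]
      refine lintegral_congr_ae ?_
      filter_upwards [hl] with x hx
      refine Tendsto.liminf_eq ?_
      refine (ENNReal.tendsto_ofReal hx).congr' ?_
      filter_upwards [self_mem_nhdsWithin] with Δ hΔ
      have hΔ : 0 < Δ := hΔ
      simp [hΔ]
    rw [e1] at key
    have h2 : ENNReal.ofReal a < ENNReal.ofReal c :=
      (ENNReal.ofReal_lt_ofReal_iff_of_nonneg ha0).2 ha
    have h3 := eventually_lt_of_lt_liminf (h2.trans_le key)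
    filter_upwards [h3, self_mem_nhdsWithin] with Δ h4 hΔ
    have hΔ : 0 < Δ := hΔ
    simp only [hΔ, if_true] at h4
    rw [← ofReal_integral_eq_lintegral_ofReal (hi Δ hΔ) (Eventually.of_forall (hn Δ hΔ))] at h4
    exact (ENNReal.ofReal_lt_ofReal_iff_of_nonneg ha0).1 h4
  · intro b hb
    filter_upwards [self_mem_nhdsWithin] with Δ hΔ
    exact (hc Δ hΔ).trans_lt hb

lemma jointPow_one_integral {μ : Measure ℝ} [IsProbabilityMeasure μ] {s : ℝ → ℝ}
    (hs : Measurable s) (F : ℝ × ℝ → ℝ) (hF : Measurable F) :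
    ∫ p, F p ∂(jointPow μ s 1) = ∫ u, F (u, s u) ∂μ := by
  have := jointPow_succ_integral (μ := μ) hs 0 F hF
  rw [zero_add] at this
  rw [this]
  unfold jointPow
  rw [Measure.dirac_prod, integral_map (by fun_prop)
    (Measurable.aestronglyMeasurable (by fun_prop))]
  simp

lemma vlim {σ : ℝ} (hσ : 0 < σ) : Tendsto (fun Δ : ℝ => σ ^ 2 * Δ) (𝓝[>] 0) (𝓝[>] 0) := by
  rw [tendsto_nhdsWithin_iff]
  constructor
  · have : Tendsto (fun Δ : ℝ => σ ^ 2 * Δ) (𝓝 0) (𝓝 (σ ^ 2 * 0)) := tendsto_id.const_mul _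
    rw [mul_zero] at this
    exact this.mono_left nhdsWithin_le_nhds
  · filter_upwards [self_mem_nhdsWithin] with Δ hΔ
    have hΔ : 0 < Δ := hΔ
    exact Set.mem_Ioi.2 (by positivity)

/-- Theorem 5.3, eq. Iaa2_Y=CPoisson (β = 2): for a Brownian motion plus compound Poisson
process, (1/Δ)·I_Δ^{θθ} → λ·L/θ² where L is the multiplicative Fisher information of the
jump law. -/
theorem stmt_12 (σ θ lam : ℝ) (hσ : 0 < σ) (hθ : 0 < θ) (hlam : 0 < lam)
    (f : ℝ → ℝ) (hf : ContDiff ℝ 1 f) (hfpos : ∀ u, 0 < f u)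
    (μ : Measure ℝ) [IsProbabilityMeasure μ]
    (hμ : μ = (volume : Measure ℝ).withDensity (fun u => ENNReal.ofReal (f u)))
    (hftail : Tendsto (fun u => u * f u) (cocompact ℝ) (𝓝 0))
    (hf' : ∃ M, ∀ u, |deriv f u| * (1 + |u|) ≤ M)
    (hL : Integrable (fun u => (u * deriv f u + f u) ^ 2 / f u)) :
    Tendsto (fun Δ : ℝ => (1 / Δ) *
        ∫ x : ℝ,
          (Real.exp (-(lam * Δ)) * ∑' k : ℕ, ((lam * Δ) ^ k / (k.factorial : ℝ)) *
              ∫ u, gauss (σ ^ 2 * Δ) (x - θ * u) * (u * (x - θ * u) / (σ ^ 2 * Δ))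
                ∂(convPow μ k)) ^ 2 /
          (Real.exp (-(lam * Δ)) * ∑' k : ℕ, ((lam * Δ) ^ k / (k.factorial : ℝ)) *
              ∫ u, gauss (σ ^ 2 * Δ) (x - θ * u) ∂(convPow μ k)))
      (𝓝[>] 0) (𝓝 (lam * (∫ u, (u * deriv f u + f u) ^ 2 / f u) / θ ^ 2)) := by
  obtain ⟨B, h⟩ := goodJump_of f hf hfpos μ hμ hftail hf' hL
  have hfc : Continuous f := hf.continuous
  have hdc : Continuous (deriv f) := hf.continuous_deriv le_rfl
  set L := ∫ u, (u * deriv f u + f u) ^ 2 / f u with hLdef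
  set s : ℝ → ℝ := fun u => (u * deriv f u + f u) / f u with hs
  have hL0 : 0 ≤ L := integral_nonneg fun u => div_nonneg (sq_nonneg _) (hfpos u).le
  have hB : 0 ≤ B := le_trans (by have := h.fpos 0; positivity) (h.fB 0)
  have sf : ∀ u, s u * f u = u * deriv f u + f u := fun u =>
    div_mul_cancel₀ _ (hfpos u).ne'
  set N : ℝ → ℝ → ℝ := fun Δ x => nMix μ s θ (lam * Δ) (σ ^ 2 * Δ) x with hN
  set P : ℝ → ℝ → ℝ := fun Δ x => pMix μ s θ (lam * Δ) (σ ^ 2 * Δ) x with hP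
  have hmain : Tendsto (fun Δ => ∫ x, 1 / (Δ * θ ^ 2) * (N Δ x ^ 2 / P Δ x)) (𝓝[>] 0)
      (𝓝 (lam * L / θ ^ 2)) := by
    refine tendsto_of_fatou
      (H := fun x => lam / θ ^ 3 * ((x / θ * deriv f (x / θ) + f (x / θ)) ^ 2 / f (x / θ)))
      ?_ ?_ ?_ ?_ ?_ ?_ ?_ ?_
    · intro Δ hΔ
      exact (mix_upper (θ := θ) h (r := lam * Δ) (v := σ ^ 2 * Δ) (by positivity)
        (by positivity)).1.const_mul _
    · intro Δ hΔ
      exact (mix_upper (θ := θ) h (r := lam * Δ) (v := σ ^ 2 * Δ) (by positivity)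
        (by positivity)).2.1.const_mul _
    · intro Δ hΔ x
      exact mul_nonneg (by positivity) ((mix_upper (θ := θ) h (r := lam * Δ) (v := σ ^ 2 * Δ)
        (by positivity) (by positivity)).2.2.1 x)
    · intro Δ hΔ
      rw [integral_const_mul]
      have := (mix_upper (θ := θ) h (r := lam * Δ) (v := σ ^ 2 * Δ) (by positivity)
        (by positivity)).2.2.2
      calc 1 / (Δ * θ ^ 2) * ∫ x, N Δ x ^ 2 / P Δ x ≤ 1 / (Δ * θ ^ 2) * (lam * Δ * L) :=
            mul_le_mul_of_nonneg_left this (by positivity)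
        _ = _ := by field_simp
    · exact (hL.comp_div hθ.ne').const_mul _
    · intro x
      exact mul_nonneg (by positivity) (div_nonneg (sq_nonneg _) (hfpos _).le)
    · rw [integral_const_mul, Measure.integral_comp_div
        (fun u => (u * deriv f u + f u) ^ 2 / f u) θ, abs_of_pos hθ, smul_eq_mul, ← hLdef]
      field_simp
    · have hne : ∀ᵐ x : ℝ, x ≠ 0 := by
        simp [ae_iff]
      filter_upwards [hne] with x hx
      have hPl : Tendsto (fun Δ => P Δ x / Δ) (𝓝[>] 0) (𝓝 (lam * (f (x / θ) / θ))) := by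
        refine poisson_small hlam (C := B / θ)
          (a := fun Δ k => ∫ p, gauss (σ ^ 2 * Δ) (x - θ * p.1) ∂(jointPow μ s k)) ?_ ?_ ?_ ?_
        · intro Δ hΔ
          exact pMix_hasSum h (by positivity) (by positivity) x
        · have t := ((gauss_div_tendsto hx).comp (vlim hσ)).const_mul (σ ^ 2)
          rw [mul_zero] at t
          refine t.congr' ?_
          filter_upwards [self_mem_nhdsWithin] with Δ hΔ
          have hΔ : 0 < Δ := hΔ
          unfold jointPow
          simp only [Function.comp, integral_dirac, mul_zero, sub_zero]
          field_simp
        · have t := (gauss_approx hθ hfc (B := B) (fun u => by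
            have := h.fB u
            rw [abs_one, one_mul] at this
            rwa [abs_of_pos (hfpos u)]) x).comp (vlim hσ)
          refine t.congr fun Δ => ?_
          have hgm := (gauss_continuous (σ ^ 2 * Δ)).measurable
          rw [jointPow_one_integral h.smeas _ (by fun_prop),
            integral_dens h.fpos h.fmeas h.hμ]
          rfl
        · intro Δ hΔ k
          refine (joint_gauss_bound h hθ (by positivity) k x).trans ?_
          have : 0 ≤ B / θ := by positivity
          have : (0 : ℝ) ≤ k := by positivity
          nlinarith
      have hNl : Tendsto (fun Δ => N Δ x / Δ) (𝓝[>] 0)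
          (𝓝 (lam * ((x / θ * deriv f (x / θ) + f (x / θ)) / θ))) := by
        refine poisson_small hlam (C := B / θ * (2 + L))
          (a := fun Δ k => ∫ p, gauss (σ ^ 2 * Δ) (x - θ * p.1) * p.2 ∂(jointPow μ s k))
          ?_ ?_ ?_ ?_
        · intro Δ hΔ
          exact nMix_hasSum h (by positivity) (by positivity) x
        · unfold jointPow
          simp
        · have t := (gauss_approx hθ (g := fun u => u * deriv f u + f u) (by fun_prop) (B := B)
            (fun u => by
              have := h.sB u
              rwa [← abs_of_pos (hfpos u), ← abs_mul, sf] at this)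
            x).comp (vlim hσ)
          refine t.congr fun Δ => ?_
          have hgm := (gauss_continuous (σ ^ 2 * Δ)).measurable
          rw [jointPow_one_integral h.smeas _ (by fun_prop),
            integral_dens h.fpos h.fmeas h.hμ]
          simp only [mul_assoc, sf]
          rfl
        · intro Δ hΔ k
          refine (joint_score_bound h hθ (by positivity) k x).trans ?_
          have hBθ : 0 ≤ B / θ := by positivity
          have hk : (0 : ℝ) ≤ k := by positivity
          rw [mul_assoc]
          refine mul_le_mul_of_nonneg_left ?_ hBθ
          nlinarith
      have hfp := hfpos (x / θ)
      have t := ((hNl.pow 2).div hPl (by positivity)).const_mul (1 / θ ^ 2)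
      have e : 1 / θ ^ 2 * ((lam * ((x / θ * deriv f (x / θ) + f (x / θ)) / θ)) ^ 2 /
          (lam * (f (x / θ) / θ))) =
          lam / θ ^ 3 * ((x / θ * deriv f (x / θ) + f (x / θ)) ^ 2 / f (x / θ)) := by
        generalize deriv f (x / θ) = d at *
        generalize f (x / θ) = y at *
        generalize x / θ * d + y = z at *
        field_simp
      rw [e] at t
      refine t.congr' ?_
      filter_upwards [self_mem_nhdsWithin] with Δ hΔ
      have hΔ : 0 < Δ := hΔ
      by_cases hP0 : P Δ x = 0
      · simp [hP0]
      · simp only [Pi.div_apply]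
        field_simp
  refine hmain.congr' ?_
  filter_upwards [self_mem_nhdsWithin] with Δ hΔ
  have hΔ : 0 < Δ := hΔ
  rw [← integral_const_mul]
  refine integral_congr_ae (Eventually.of_forall fun x => ?_)
  simp only
  rw [pMix_eq h (by positivity) (by positivity), nMix_eq h hθ (by positivity) (by positivity)]
  simp only [hN, hP, mul_pow, neg_sq, div_pow, one_pow]
  rw [one_div_mul_eq_div, one_div_mul_eq_div, one_div_mul_eq_div, div_div, div_div, div_div]
  congr 1
  ring
end
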